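/- arXiv:2007.05744 — 3 statements merged into one kernel-verified Lean document; each statement's English description precedes it below -/
import Mathlib

section
/- Let 0 = D_0 ⊊ D_1 ⊊ … ⊊ D_r = M be the dimension filtration of M with respect to Q. Then for each i = 1, …, r, the set of associated primes of D_i/D_{i-1} equals {p ∈ Ass(M) : cd(Q, S/p) = cd(Q, D_i)}. -/
open CategoryTheory MvPolynomial

noncomputable section

/-- The standard bigraded polynomial ring `S = K[x_1,…,x_m, y_1,…,y_n]`. -/
abbrev BGS (K : Type) [Field K] (m n : ℕ) : Type := MvPolynomial (Fin m ⊕ Fin n) K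

/-- The bigrading weights: `deg x_i = (1,0)`, `deg y_j = (0,1)`. -/
def bwt (m n : ℕ) : Fin m ⊕ Fin n → ℕ × ℕ := Sum.elim (fun _ => (1, 0)) (fun _ => (0, 1))

/-- `P = (x_1, …, x_m)`. -/
def idealP (K : Type) [Field K] (m n : ℕ) : Ideal (BGS K m n) :=
  Ideal.span (Set.range fun i : Fin m => (X (Sum.inl i) : BGS K m n))

/-- `Q = (y_1, …, y_n)`. -/
def idealQ (K : Type) [Field K] (m n : ℕ) : Ideal (BGS K m n) :=
  Ideal.span (Set.range fun j : Fin n => (X (Sum.inr j) : BGS K m n))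

/-- `cd(J, M)`: the cohomological dimension, i.e. the largest `i` such that the local
cohomology module `H^i_J(M)` is nonzero. -/
def cohDim (R : Type) [CommRing R] (J : Ideal R) (M : Type) [AddCommGroup M] [Module R M] : ℕ :=
  sSup {i : ℕ | Nontrivial ((localCohomology J i).obj (ModuleCat.of R M))}

/-- `grade(J, M)`: the least `i` with `Ext^i(R/J, M) ≠ 0`. -/
def extGrade (R : Type) [CommRing R] (J : Ideal R) (M : Type) [AddCommGroup M] [Module R M] : ℕ :=
  sInf {i : ℕ | Nontrivial
    (((Ext R (ModuleCat R) i).obj (Opposite.op (ModuleCat.of R (R ⧸ J)))).obj (ModuleCat.of R M))}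

/-- `mgrade(J, M) = min {cd(J, R/p) : p ∈ Ass(M)}`. -/
def mCohDim (R : Type) [CommRing R] (J : Ideal R) (M : Type) [AddCommGroup M] [Module R M] : ℕ :=
  sInf ((fun p => cohDim R J (R ⧸ p)) '' associatedPrimes R M)

/-- `M` has maximal depth with respect to `J` if `grade(J, M) = mgrade(J, M)`. -/
def HasMaximalDepth (R : Type) [CommRing R] (J : Ideal R) (M : Type) [AddCommGroup M]
    [Module R M] : Prop :=
  extGrade R J M = mCohDim R J M

/-- A bigrading on an `S`-module `M`: an internal direct sum decomposition indexed by `ℕ × ℕ`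
compatible with the bigrading of `S`. -/
structure IsBigrading (K : Type) [Field K] (m n : ℕ) (M : Type) [AddCommGroup M]
    [Module (BGS K m n) M] (ℳ : ℕ × ℕ → AddSubgroup M) : Prop where
  internal : DirectSum.IsInternal ℳ
  smul_mem : ∀ (d e : ℕ × ℕ) (s : BGS K m n) (x : M),
    IsWeightedHomogeneous (bwt m n) s d → x ∈ ℳ e → s • x ∈ ℳ (d + e)

/-- A submodule is bigraded if it is generated by bihomogeneous elements. -/
def IsBigradedSubmodule (K : Type) [Field K] (m n : ℕ) {M : Type} [AddCommGroup M]
    [Module (BGS K m n) M] (ℳ : ℕ × ℕ → AddSubgroup M) (N : Submodule (BGS K m n) M) : Prop :=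
  N = Submodule.span (BGS K m n) {x : M | x ∈ N ∧ ∃ d, x ∈ ℳ d}
/-- The dimension filtration of `M` with respect to `Q`:
`D i.castSucc` is the largest bigraded submodule of `D i.succ` whose cohomological
dimension with respect to `Q` is strictly smaller than that of `D i.succ`. -/
structure IsDimFiltration (K : Type) [Field K] (m n : ℕ) {M : Type} [AddCommGroup M]
    [Module (BGS K m n) M] (ℳ : ℕ × ℕ → AddSubgroup M) (r : ℕ)
    (D : Fin (r + 1) → Submodule (BGS K m n) M) : Prop where
  strictMono : StrictMono D
  bot : D 0 = ⊥
  top : D (Fin.last r) = ⊤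
  bigraded : ∀ i, IsBigradedSubmodule K m n ℳ (D i)
  cd_lt : ∀ i : Fin r, cohDim (BGS K m n) (idealQ K m n) ↥(D i.castSucc) <
    cohDim (BGS K m n) (idealQ K m n) ↥(D i.succ)
  largest : ∀ (i : Fin r) (N : Submodule (BGS K m n) M), IsBigradedSubmodule K m n ℳ N →
    N ≤ D i.succ →
    cohDim (BGS K m n) (idealQ K m n) ↥N < cohDim (BGS K m n) (idealQ K m n) ↥(D i.succ) →
    N ≤ D i.castSucc

open Limits


section hom
variable {A : Type*} [Category A] [Abelian A] (K L : ChainComplex A ℕ) (I : A) [Injective I] (p : ℕ)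

/-- The map out of homology induced by a cocycle `K_{p+1} → I`. -/
noncomputable def hmk (f : K.X (p+1) ⟶ I) (hf : K.d (p+2) (p+1) ≫ f = 0) :
    K.homology (p+1) ⟶ I :=
  K.homologyι (p+1) ≫ K.descOpcycles f (p+2) (by simp) hf

lemma hmk_surj (g : K.homology (p+1) ⟶ I) : ∃ f hf, hmk K I p f hf = g := by
  refine ⟨K.pOpcycles (p+1) ≫ Injective.factorThru g (K.homologyι (p+1)), by simp, ?_⟩
  have : K.descOpcycles (K.pOpcycles (p+1) ≫ Injective.factorThru g (K.homologyι (p+1))) (p+2)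
    (by simp) (by simp) = Injective.factorThru g (K.homologyι (p+1)) := by
    rw [← cancel_epi (K.pOpcycles (p+1))]; simp
  simp [hmk, this]

lemma hmk_eq_zero (f : K.X (p+1) ⟶ I) (hf : K.d (p+2) (p+1) ≫ f = 0) :
    hmk K I p f hf = 0 ↔ ∃ g : K.X p ⟶ I, K.d (p+1) p ≫ g = f := by
  constructor
  · intro h
    have ex : (ShortComplex.mk (K.homologyι (p+1)) (K.fromOpcycles (p+1) p) (by simp)).Exact :=
      ShortComplex.exact_of_f_is_kernel _ (K.homologyIsKernel (p+1) p (by simp))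
    refine ⟨ex.descToInjective (K.descOpcycles f (p+2) (by simp) hf) h, ?_⟩
    have := ex.comp_descToInjective (K.descOpcycles f (p+2) (by simp) hf) h
    dsimp at this
    rw [← K.p_fromOpcycles, Category.assoc, this]
    simp
  · rintro ⟨g, rfl⟩
    have : K.descOpcycles (K.d (p+1) p ≫ g) (p+2) (by simp) hf = K.fromOpcycles (p+1) p ≫ g := by
      rw [← cancel_epi (K.pOpcycles (p+1))]; simp
    simp [hmk, this]

lemma hmk_nat (φ : L ⟶ K) (f : K.X (p+1) ⟶ I) (hf : K.d (p+2) (p+1) ≫ f = 0) :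
    HomologicalComplex.homologyMap φ (p+1) ≫ hmk K I p f hf =
      hmk L I p (φ.f (p+1) ≫ f) (by rw [← φ.comm_assoc, hf, comp_zero]) := by
  simp only [hmk, HomologicalComplex.homologyι_naturality_assoc]
  congr 1
  rw [← cancel_epi (L.pOpcycles (p+1))]; simp
end hom

section colim

lemma colim_subsingleton_iff {R : Type} [CommRing R] {D : Type} [SmallCategory D] [IsFiltered D]
    (G : D ⥤ ModuleCat.{0} R) : Subsingleton (colimit G : ModuleCat.{0} R) ↔
    ∀ (j : D) (x : G.obj j), ∃ (k : D) (a : j ⟶ k), G.map a x = 0 := by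
  constructor
  · intro hs s x
    exact Concrete.colimit_rep_eq_zero.{0,0} R G s x (Subsingleton.elim _ _)
  · intro h
    refine subsingleton_of_forall_eq 0 fun y => ?_
    obtain ⟨j, x, rfl⟩ := Concrete.colimit_exists_rep G y
    obtain ⟨t, a, h1⟩ := h j x
    rw [← colimit.w G a, ModuleCat.comp_apply, h1, map_zero]

variable {R : Type} [CommRing R] (J : Ideal R) (M : ModuleCat.{0} R) (i : ℕ)

/-- The transition maps `R/J^t → R/J^s`. -/
noncomputable def powTr {s t : ℕ} (h : s ≤ t) :
    ModuleCat.of R (R ⧸ J ^ t) ⟶ ModuleCat.of R (R ⧸ J ^ s) :=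
  ModuleCat.ofHom <| Submodule.mapQ _ _ LinearMap.id (Ideal.pow_le_pow_right h)

lemma lc_iff : Subsingleton ((localCohomology J i).obj M) ↔
   ∀ (s : ℕ) (x : ((Ext R (ModuleCat R) i).obj (Opposite.op (ModuleCat.of R (R ⧸ J ^ s)))).obj M),
     ∃ (t : ℕ) (h : s ≤ t), ((Ext R (ModuleCat R) i).map (powTr J h).op).app M x = 0 := by
  let F := localCohomology.diagram (localCohomology.idealPowersDiagram J) i
  have hF : HasColimit F := localCohomology.hasColimitDiagram.{0,0} _ i
  let e : (localCohomology J i).obj M ≅ colimit (F ⋙ (evaluation _ _).obj M) := 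
    colimitObjIsoColimitCompEvaluation F M
  rw [e.toLinearEquiv.toEquiv.subsingleton_congr, colim_subsingleton_iff]
  constructor
  · intro h s x
    obtain ⟨j, a, ha⟩ := h (Opposite.op (Opposite.op s)) x
    exact ⟨j.unop.unop, leOfHom a.unop.unop, ha⟩
  · intro h j x
    obtain ⟨t, ht, h0⟩ := h j.unop.unop x
    exact ⟨Opposite.op (Opposite.op t), (homOfLE ht).op.op, h0⟩
end colim


section cls
variable {R : Type} [CommRing R]

instance injR : Injective (Opposite.op (ModuleCat.of R R)) := by
  have : Projective (ModuleCat.of R R) := ModuleCat.projective_of_free (Module.Basis.singleton Unit R)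
  infer_instance

/-- elements as maps -/
noncomputable def toI {E : (ModuleCat.{0} R)ᵒᵖ} (x : E.unop) : E ⟶ Opposite.op (ModuleCat.of R R) :=
  (ModuleCat.ofHom (LinearMap.toSpanSingleton R _ x)).op

lemma toI_unop_one {E : (ModuleCat.{0} R)ᵒᵖ} (x : E.unop) : (toI x).unop.hom 1 = x := by
  simp [toI]

lemma toI_of_unop_one {E : (ModuleCat.{0} R)ᵒᵖ} (f : E ⟶ Opposite.op (ModuleCat.of R R)) :
    toI (f.unop.hom 1) = f := by
  apply Quiver.Hom.unop_inj
  ext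
  simp [toI]

lemma comp_toI {E E' : (ModuleCat.{0} R)ᵒᵖ} (u : E' ⟶ E) (x : E.unop) :
    u ≫ toI x = toI (u.unop.hom x) := by
  apply Quiver.Hom.unop_inj
  ext
  simp [toI]

lemma toI_inj {E : (ModuleCat.{0} R)ᵒᵖ} {x y : E.unop} (h : toI x = toI y) : x = y := by
  rw [← toI_unop_one x, h, toI_unop_one]

lemma toI_zero {E : (ModuleCat.{0} R)ᵒᵖ} : toI (0 : E.unop) = 0 := by
  apply Quiver.Hom.unop_inj
  ext
  simp [toI]

variable (K L : ChainComplex (ModuleCat.{0} R)ᵒᵖ ℕ) (p : ℕ)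

lemma toI_cond (f : (K.X (p+1)).unop) (hf : (K.d (p+2) (p+1)).unop.hom f = 0) :
    K.d (p+2) (p+1) ≫ toI f = 0 := by rw [comp_toI, hf, toI_zero]

/-- class of a cocycle -/
noncomputable def cls (f : (K.X (p+1)).unop) (hf : (K.d (p+2) (p+1)).unop.hom f = 0) :
    (K.homology (p+1)).unop :=
  (hmk K (Opposite.op (ModuleCat.of R R)) p (toI f) (toI_cond K p f hf)).unop.hom 1

lemma toI_cls (f : (K.X (p+1)).unop) (hf : (K.d (p+2) (p+1)).unop.hom f = 0) :
    toI (cls K p f hf) = hmk K _ p (toI f) (toI_cond K p f hf) := toI_of_unop_one _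

lemma cls_surj (x : (K.homology (p+1)).unop) : ∃ f hf, cls K p f hf = x := by
  obtain ⟨f, hf, h⟩ := hmk_surj K (Opposite.op (ModuleCat.of R R)) p (toI x)
  refine ⟨f.unop.hom 1, ?_, ?_⟩
  · apply toI_inj
    rw [← comp_toI, toI_of_unop_one, hf, toI_zero]
  · apply toI_inj
    rw [toI_cls, ← h]
    congr
    rw [toI_of_unop_one]

lemma cls_eq_zero (f : (K.X (p+1)).unop) (hf : (K.d (p+2) (p+1)).unop.hom f = 0) :
    cls K p f hf = 0 ↔ ∃ g : (K.X p).unop, (K.d (p+1) p).unop.hom g = f := by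
  have : cls K p f hf = 0 ↔ hmk K _ p (toI f) (toI_cond K p f hf) = 0 := by
    rw [← toI_cls K p f hf]
    exact ⟨fun h => by rw [h, toI_zero], fun h => toI_inj (by rw [h, toI_zero])⟩
  rw [this, hmk_eq_zero]
  constructor
  · rintro ⟨g, hg⟩
    exact ⟨g.unop.hom 1, toI_inj (by rw [← comp_toI, toI_of_unop_one, hg])⟩
  · rintro ⟨g, hg⟩
    exact ⟨toI g, by rw [comp_toI, hg]⟩

lemma cls_nat (φ : L ⟶ K) (f : (K.X (p+1)).unop) (hf : (K.d (p+2) (p+1)).unop.hom f = 0)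
    (hf' : (L.d (p+2) (p+1)).unop.hom ((φ.f (p+1)).unop.hom f) = 0) :
    (HomologicalComplex.homologyMap φ (p+1)).unop.hom (cls K p f hf) =
      cls L p ((φ.f (p+1)).unop.hom f) hf' := by
  apply toI_inj
  rw [← comp_toI, toI_cls, toI_cls, hmk_nat]
  congr 1
  rw [comp_toI]

end cls

section bridge
variable {R : Type} [CommRing R] {X X' : ModuleCat.{0} R} (P : ProjectiveResolution X) 
  (P' : ProjectiveResolution X') (Y : ModuleCat.{0} R) (p : ℕ)

/-- functor -/
noncomputable abbrev FY : ModuleCat.{0} R ⥤ (ModuleCat.{0} R)ᵒᵖ := ((linearYoneda R (ModuleCat.{0} R)).obj Y).rightOp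

/-- complex -/
noncomputable abbrev KY : ChainComplex (ModuleCat.{0} R)ᵒᵖ ℕ :=
  ((FY Y).mapHomologicalComplex _).obj P.complex

/-- class -/
noncomputable def oldMk (f : P.complex.X (p+1) ⟶ Y) (hf : P.complex.d (p+2) (p+1) ≫ f = 0) :
    ((Ext R (ModuleCat R) (p+1)).obj (Opposite.op X)).obj Y :=
  (P.isoLeftDerivedObj (FY Y) (p+1)).hom.unop.hom (cls (KY P Y) p f hf)

lemma oldMk_surj (x : ((Ext R (ModuleCat R) (p+1)).obj (Opposite.op X)).obj Y) :
   ∃ f hf, oldMk P Y p f hf = x := by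
  obtain ⟨f, hf, h⟩ := cls_surj (KY P Y) p ((P.isoLeftDerivedObj (FY Y) (p+1)).inv.unop.hom x)
  refine ⟨f, hf, ?_⟩
  unfold oldMk
  rw [h]
  have := congrArg (fun u => u.unop.hom x) (P.isoLeftDerivedObj (FY Y) (p+1)).hom_inv_id
  exact this

lemma oldMk_eq_zero (f : P.complex.X (p+1) ⟶ Y) (hf : P.complex.d (p+2) (p+1) ≫ f = 0) :
    oldMk P Y p f hf = 0 ↔ ∃ g : P.complex.X p ⟶ Y, P.complex.d (p+1) p ≫ g = f := by
  refine Iff.trans ?_ (cls_eq_zero (KY P Y) p f hf)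
  unfold oldMk
  constructor
  · intro h
    have := congrArg (fun u => u.unop.hom (cls (KY P Y) p f hf)) (P.isoLeftDerivedObj (FY Y) (p+1)).inv_hom_id
    refine Eq.trans this.symm ?_
    refine Eq.trans (congrArg (P.isoLeftDerivedObj (FY Y) (p+1)).inv.unop.hom h) (map_zero _)
  · intro h
    exact (congrArg (P.isoLeftDerivedObj (FY Y) (p+1)).hom.unop.hom h).trans (map_zero _)

lemma oldMk_nat {g : X' ⟶ X} (φ : ProjectiveResolution.Hom P' P g) (f : P.complex.X (p+1) ⟶ Y)
    (hf : P.complex.d (p+2) (p+1) ≫ f = 0) :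
    ((Ext R (ModuleCat R) (p+1)).map g.op).app Y (oldMk P Y p f hf) = 
     oldMk P' Y p (φ.hom.f (p+1) ≫ f) (by rw [← φ.hom.comm_assoc, hf, comp_zero]) := by
  have h := ProjectiveResolution.isoLeftDerivedObj_hom_naturality g P' P φ.hom 
    (by simpa using φ.hom_f_zero_comp_π_f_zero) (FY Y) (p+1)
  have h2 := congrArg (fun u => u.unop.hom (cls (KY P Y) p f hf)) h
  have e : ((Ext R (ModuleCat R) (p+1)).map g.op).app Y = (((FY Y).leftDerived (p+1)).map g).unop := rfl
  have h3 : ((Ext R (ModuleCat R) (p+1)).map g.op).app Y (oldMk P Y p f hf) =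
     (((FY Y).leftDerived (p+1)).map g ≫ (P.isoLeftDerivedObj (FY Y) (p+1)).hom).unop.hom (cls (KY P Y) p f hf) := by
    rw [e]; rfl
  refine h3.trans (Eq.trans h2 ?_)
  have := cls_nat (KY P Y) (KY P' Y) p (((FY Y).mapHomologicalComplex _).map φ.hom) f hf
    (show P'.complex.d (p+2) (p+1) ≫ φ.hom.f (p+1) ≫ f = 0 by rw [← φ.hom.comm_assoc, hf, comp_zero])
  have h4 := congrArg (fun z => (P'.isoLeftDerivedObj (FY Y) (p+1)).hom.unop.hom z) this
  refine Eq.trans ?_ (h4.trans ?_)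
  · rfl
  · unfold oldMk
    congr 1

open Abelian in
lemma old_new (s : ℕ → ModuleCat.{0} R) (a : ℕ) (g : ∀ b, a ≤ b → (s b ⟶ s a)) :
    (∀ x : ((_root_.Ext R (ModuleCat R) (p+1)).obj (Opposite.op (s a))).obj Y, ∃ b, ∃ h : a ≤ b,
      ((_root_.Ext R (ModuleCat R) (p+1)).map (g b h).op).app Y x = 0) ↔
    ∀ x : Abelian.Ext (s a) Y (p+1), ∃ b, ∃ h : a ≤ b, 
      (Ext.mk₀ (g b h)).comp x (zero_add _) = 0 := by
  let P (n) := projectiveResolution (s n)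
  have hh : ∀ b (h : a ≤ b), Nonempty (ProjectiveResolution.Hom (P b) (P a) (g b h)) := fun b h =>
    ⟨⟨ProjectiveResolution.lift (g b h) (P b) (P a), by
      exact HomologicalComplex.congr_hom (ProjectiveResolution.lift_commutes (g b h) (P b) (P a)) 0⟩⟩
  let ψ (b) (h : a ≤ b) := (hh b h).some
  have key : ∀ (f : (P a).complex.X (p+1) ⟶ Y) (hf : (P a).complex.d (p+2) (p+1) ≫ f = 0) (b) (h : a ≤ b),
     ((_root_.Ext R (ModuleCat R) (p+1)).map (g b h).op).app Y (oldMk (P a) Y p f hf) = 0 ↔ 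
     (Ext.mk₀ (g b h)).comp ((P a).extMk f (p+2) rfl hf) (zero_add _) = 0 := by
    intro f hf b h
    rw [oldMk_nat (P a) (P b) Y p (ψ b h), oldMk_eq_zero, ProjectiveResolution.mk₀_comp_extMk (φ := ψ b h),
      ProjectiveResolution.extMk_eq_zero_iff _ _ _ _ _ p rfl]
  constructor
  · intro H x
    obtain ⟨f, hf, rfl⟩ := (P a).extMk_surjective x (p+2) rfl
    obtain ⟨b, h, H⟩ := H (oldMk (P a) Y p f hf)
    exact ⟨b, h, (key f hf b h).1 H⟩
  · intro H x
    obtain ⟨f, hf, rfl⟩ := oldMk_surj (P a) Y p x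
    obtain ⟨b, h, H⟩ := H ((P a).extMk f (p+2) rfl hf)
    exact ⟨b, h, (key f hf b h).2 H⟩

open Abelian in
lemma lc_iff_ext (J : Ideal R) : Subsingleton ((localCohomology J (p+1)).obj Y) ↔
   ∀ (s : ℕ) (x : Abelian.Ext (ModuleCat.of R (R ⧸ J ^ s)) Y (p+1)),
     ∃ (t : ℕ) (h : s ≤ t), (Ext.mk₀ (powTr J h)).comp x (zero_add _) = 0 := by
  rw [lc_iff]
  refine forall_congr' fun a => ?_
  exact old_new Y p (fun n => ModuleCat.of R (R ⧸ J ^ n)) a (fun b h => powTr J h)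
end bridge


section LC
variable {R : Type} [CommRing R] (J : Ideal R)

/-- vanishing of local cohomology -/
def LCV (i : ℕ) (M : Type) [AddCommGroup M] [Module R M] : Prop :=
  Subsingleton ((localCohomology J i).obj (ModuleCat.of R M))

lemma powTr_comp {s t u : ℕ} (h : s ≤ t) (h' : t ≤ u) :
    powTr J h' ≫ powTr J h = powTr J (h.trans h') := by
  refine ModuleCat.hom_ext (LinearMap.ext fun x => ?_)
  obtain ⟨x, rfl⟩ := Submodule.Quotient.mk_surjective _ x
  rfl

variable {M N L : Type} [AddCommGroup M] [Module R M] [AddCommGroup N] [Module R N]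
  [AddCommGroup L] [Module R L]

variable {J}
lemma LCV.equiv {i : ℕ} (h : LCV J i M) (e : M ≃ₗ[R] N) : LCV J i N := by
  unfold LCV at *
  exact (((localCohomology J i).mapIso e.toModuleIso).toLinearEquiv.toEquiv.subsingleton_congr).1 h

lemma LCV.of_subsingleton (p : ℕ) [Subsingleton M] : LCV J (p+1) M := by
  unfold LCV
  have h : IsZero (ModuleCat.of R M) := ModuleCat.isZero_of_subsingleton _
  rw [lc_iff_ext]
  intro s x
  refine ⟨s, le_rfl, ?_⟩
  have : x = 0 := by
    have h2 := Abelian.Ext.comp_mk₀_id x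
    rw [h.eq_of_src (𝟙 _) 0] at h2
    rw [← h2]; simp
  rw [this]; simp

lemma shortExact_of {f : M →ₗ[R] N} {g : N →ₗ[R] L} (hf : Function.Injective f)
    (hg : Function.Surjective g) (hfg : Function.Exact f g) :
    (ShortComplex.mk (ModuleCat.ofHom f) (ModuleCat.ofHom g) (by
      rw [← ModuleCat.ofHom_comp, hfg.linearMap_comp_eq_zero]; rfl)).ShortExact :=
  ModuleCat.shortComplex_shortExact _ hfg hf hg

open Abelian in
lemma LCV.mid {p : ℕ} {f : M →ₗ[R] N} {g : N →ₗ[R] L} (hf : Function.Injective f)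
    (hg : Function.Surjective g) (hfg : Function.Exact f g)
    (h1 : LCV J (p+1) M) (h3 : LCV J (p+1) L) : LCV J (p+1) N := by
  unfold LCV at *
  rw [lc_iff_ext] at *
  have hS := shortExact_of hf hg hfg
  intro s x
  obtain ⟨t, ht, h⟩ := h3 s (x.comp (Ext.mk₀ (ModuleCat.ofHom g)) (add_zero _))
  rw [← Ext.comp_assoc (h₁₂ := zero_add _) (h₂₃ := add_zero _) (h := by omega)] at h
  obtain ⟨y, hy⟩ := Ext.covariant_sequence_exact₂ _ hS _ h
  obtain ⟨u, hu, h'⟩ := h1 t y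
  refine ⟨u, ht.trans hu, ?_⟩
  rw [← powTr_comp J ht hu, ← Ext.mk₀_comp_mk₀,
    Ext.comp_assoc (h₁₂ := zero_add _) (h₂₃ := zero_add _) (h := by omega), ← hy,
    ← Ext.comp_assoc (h₁₂ := zero_add _) (h₂₃ := add_zero _) (h := by omega), h', Ext.zero_comp]

open Abelian in
lemma LCV.right {p : ℕ} {f : M →ₗ[R] N} {g : N →ₗ[R] L} (hf : Function.Injective f)
    (hg : Function.Surjective g) (hfg : Function.Exact f g)
    (h1 : LCV J (p+2) M) (h2 : LCV J (p+1) N) : LCV J (p+1) L := by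
  unfold LCV at *
  rw [lc_iff_ext] at *
  have hS := shortExact_of hf hg hfg
  intro s x
  obtain ⟨t, ht, h⟩ := h1 s (x.comp hS.extClass rfl)
  rw [← Ext.comp_assoc (h₁₂ := zero_add _) (h₂₃ := rfl) (h := by omega)] at h
  obtain ⟨y, hy⟩ := Ext.covariant_sequence_exact₃ _ hS _ _ h
  obtain ⟨u, hu, h'⟩ := h2 t y
  refine ⟨u, ht.trans hu, ?_⟩
  rw [← powTr_comp J ht hu, ← Ext.mk₀_comp_mk₀,
    Ext.comp_assoc (h₁₂ := zero_add _) (h₂₃ := zero_add _) (h := by omega), ← hy,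
    ← Ext.comp_assoc (h₁₂ := zero_add _) (h₂₃ := add_zero _) (h := by omega), h', Ext.zero_comp]

variable [IsNoetherianRing R]

lemma ann_exact {f : M →ₗ[R] N} {g : N →ₗ[R] L} (hf : Function.Injective f)
    (hg : Function.Surjective g) (I : Ideal R) (h : I ≤ Module.annihilator R N) :
    I ≤ Module.annihilator R M ∧ I ≤ Module.annihilator R L :=
  ⟨h.trans (f.annihilator_le_of_injective hf), h.trans (g.annihilator_le_of_surjective hg)⟩

lemma LCV.of_primes (p : ℕ) (I : Ideal R)
    (H : ∀ q : Ideal R, q.IsPrime → I ≤ q → LCV J (p+1) (R ⧸ q))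
    (M : Type) [AddCommGroup M] [Module R M] [Module.Finite R M]
    (hI : I ≤ Module.annihilator R M) : LCV J (p+1) M := by
  revert hI
  refine IsNoetherianRing.induction_on_isQuotientEquivQuotientPrime R (M := M) inferInstance 
    (motive := fun N _ _ _ => I ≤ Module.annihilator R N → LCV J (p+1) N) ?_ ?_ ?_
  · intro N _ _ _ _ _
    exact LCV.of_subsingleton p
  · intro N _ _ _ q e hI
    refine (H q.1 q.2 ?_).equiv e.symm
    rwa [e.annihilator_eq, Ideal.annihilator_quotient] at hI
  · intro N₁ _ _ _ N₂ _ _ _ N₃ _ _ _ f g hf hg hfg h1 h3 hI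
    obtain ⟨a, b⟩ := ann_exact hf hg I hI
    exact LCV.mid hf hg hfg (h1 a) (h3 b)

lemma LCV.step (p : ℕ) (N : Type) [AddCommGroup N] [Module R N] [Module.Finite R N]
    (hN : LCV J (p+1) N)
    (H : ∀ (M : Type) [AddCommGroup M] [Module R M] [Module.Finite R M],
      Module.annihilator R N ≤ Module.annihilator R M → LCV J (p+2) M)
    (q : Ideal R) (hq : q.IsPrime) (hqN : Module.annihilator R N ≤ q) : LCV J (p+1) (R ⧸ q) := by
  induction q using IsNoetherian.induction with
  | hgt q ih =>
  have hne : ¬ Subsingleton (N →ₗ[R] R ⧸ q) := by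
    rw [IsSMulRegular.subsingleton_linearMap_iff]
    rintro ⟨r, hr, hreg⟩
    have : (Ideal.Quotient.mk q 1) = 0 := by
      apply hreg
      show r • Ideal.Quotient.mk q 1 = r • (0 : R ⧸ q)
      rw [smul_zero, Algebra.smul_def]
      simpa [Ideal.Quotient.eq_zero_iff_mem] using hqN hr
    rw [Ideal.Quotient.eq_zero_iff_mem] at this
    exact hq.ne_top ((Ideal.eq_top_iff_one _).2 this)
  rw [not_subsingleton_iff_nontrivial] at hne
  obtain ⟨f, hf⟩ := exists_ne (0 : N →ₗ[R] R ⧸ q)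
  have hk : LCV J (p+2) (LinearMap.ker f) :=
    H _ ((LinearMap.ker f).subtype.annihilator_le_of_injective (Submodule.subtype_injective _))
  have hW : LCV J (p+1) (LinearMap.range f) :=
    LCV.right (f := (LinearMap.ker f).subtype) (g := f.rangeRestrict) (Submodule.subtype_injective _)
      f.surjective_rangeRestrict (by
        rw [LinearMap.exact_iff, LinearMap.ker_rangeRestrict, Submodule.range_subtype]) hk hN
  refine LCV.mid (f := (LinearMap.range f).subtype) (g := (LinearMap.range f).mkQ)
    (Submodule.subtype_injective _) (Submodule.mkQ_surjective _)
    (LinearMap.exact_subtype_mkQ _) hW ?_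
  refine LCV.of_primes p (Module.annihilator R ((R ⧸ q) ⧸ LinearMap.range f)) ?_ _ le_rfl
  intro q' hq' hle
  have hqa : q < Module.annihilator R ((R ⧸ q) ⧸ LinearMap.range f) := by
    have h1 : q ≤ Module.annihilator R ((R ⧸ q) ⧸ LinearMap.range f) := by
      conv_lhs => rw [← Ideal.annihilator_quotient (I := q)]
      exact (LinearMap.range f).mkQ.annihilator_le_of_surjective (Submodule.mkQ_surjective _)
    refine lt_of_le_of_ne h1 fun he => hf ?_
    ext x
    obtain ⟨y, hy⟩ := Ideal.Quotient.mk_surjective (f x)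
    have : y ∈ Module.annihilator R ((R ⧸ q) ⧸ LinearMap.range f) := by
      rw [Module.mem_annihilator]
      intro z
      obtain ⟨z, rfl⟩ := Submodule.mkQ_surjective _ z
      obtain ⟨z, rfl⟩ := Ideal.Quotient.mk_surjective z
      rw [← map_smul, Submodule.mkQ_apply, Submodule.Quotient.mk_eq_zero]
      refine ⟨z • x, ?_⟩
      rw [map_smul, ← hy, Algebra.smul_def, Algebra.smul_def, mul_comm]
      rfl
    rw [← he] at this
    rw [← hy, Ideal.Quotient.eq_zero_iff_mem.2 this]; rfl
  exact ih q' (lt_of_lt_of_le hqa hle) hq' (hqN.trans (hqa.le.trans hle))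

/-- Monotonicity of cohomological dimension in the support. -/
lemma LCV.support (B : ℕ) (hB : ∀ (M : Type) [AddCommGroup M] [Module R M] (i : ℕ), B < i → LCV J i M)
    (c : ℕ) (N : Type) [AddCommGroup N] [Module R N] [Module.Finite R N]
    (hN : ∀ i, c < i → LCV J i N) (i : ℕ) (hi : c < i) 
    (M : Type) [AddCommGroup M] [Module R M] [Module.Finite R M]
    (hM : Module.annihilator R N ≤ Module.annihilator R M) : LCV J i M := by
  obtain ⟨k, hk⟩ : ∃ k, B < i + k := ⟨B + 1, by omega⟩
  induction k generalizing i M with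
  | zero => exact hB M i hk
  | succ k ih =>
    obtain ⟨p, rfl⟩ : ∃ p, i = p + 1 := ⟨i - 1, by omega⟩
    refine LCV.of_primes p _ ?_ M hM
    intro q hq hle
    refine LCV.step p N (hN _ hi) ?_ q hq hle
    intro M _ _ _ h
    exact ih (p+2) (by omega) M h (by omega)
end LC


section bdd
open MvPolynomial
variable {σ K : Type} [Field K]

/-- ideal generated by `s`-th powers of variables in `T` -/
noncomputable def powId (s : ℕ) (T : Set σ) : Ideal (MvPolynomial σ K) :=
  Ideal.span ((fun e => monomial e (1 : K)) '' ((fun j => Finsupp.single j s) '' T))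

lemma powId_reg (s : ℕ) (T : Set σ) (a : σ) (ha : a ∉ T) (f : MvPolynomial σ K)
    (h : f * X a ^ s ∈ powId (K := K) s T) : f ∈ powId (K := K) s T := by
  classical
  unfold powId at *
  rw [mem_ideal_span_monomial_image] at *
  intro e he
  have h1 : e + Finsupp.single a s ∈ (f * X a ^ s).support := by
    rw [mem_support_iff, X_pow_eq_monomial, coeff_mul_monomial]
    simpa using he
  obtain ⟨_, ⟨j, hj, rfl⟩, hle⟩ := h _ h1
  refine ⟨_, ⟨j, hj, rfl⟩, ?_⟩
  have hja : a ≠ j := fun h => ha (h ▸ hj)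
  intro k
  have := hle k
  by_cases hk : j = k
  · subst hk; simpa [Finsupp.single_apply, hja] using this
  · simp [Finsupp.single_apply, hk]

lemma powId_insert (s : ℕ) (T : Set σ) (a : σ) (f : MvPolynomial σ K) :
    f ∈ powId (K := K) s (insert a T) ↔ ∃ g, f - g * X a ^ s ∈ powId (K := K) s T := by
  unfold powId
  rw [Set.image_insert_eq, Set.image_insert_eq, Ideal.mem_span_insert]
  constructor
  · rintro ⟨g, z, hz, rfl⟩
    refine ⟨g, ?_⟩
    simpa [X_pow_eq_monomial] using hz
  · rintro ⟨g, hg⟩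
    refine ⟨g, _, hg, ?_⟩
    simp [X_pow_eq_monomial]

lemma powId_pd (s : ℕ) (T : Finset σ) :
    HasProjectiveDimensionLT (ModuleCat.of (MvPolynomial σ K) (MvPolynomial σ K ⧸ powId (K := K) s (T : Set σ))) (T.card + 1) := by
  classical
  induction T using Finset.induction_on with
  | empty =>
    have e : (MvPolynomial σ K ⧸ powId (K := K) s ((∅ : Finset σ) : Set σ)) ≃ₗ[MvPolynomial σ K] MvPolynomial σ K :=
      Submodule.quotEquivOfEqBot _ (by simp [powId])
    have : Module.Projective (MvPolynomial σ K) (MvPolynomial σ K ⧸ powId (K := K) s ((∅ : Finset σ) : Set σ)) :=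
      Module.Projective.of_equiv e.symm
    rw [Finset.card_empty, ← projective_iff_hasProjectiveDimensionLT_one]
    rw [← IsProjective.iff_projective]
    exact this
  | insert a T ha ih =>
    rw [Finset.card_insert_of_notMem ha, Finset.coe_insert]
    set I : Ideal (MvPolynomial σ K) := powId (K := K) s (T : Set σ)
    set I' : Ideal (MvPolynomial σ K) := powId (K := K) s (insert a (T : Set σ))
    have hle : I ≤ I' := fun f hf => (powId_insert s _ a f).2 ⟨0, by simpa using hf⟩
    let f : (MvPolynomial σ K ⧸ I) →ₗ[MvPolynomial σ K] (MvPolynomial σ K ⧸ I) :=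
      LinearMap.lsmul (MvPolynomial σ K) (MvPolynomial σ K ⧸ I) (X a ^ s)
    let g : (MvPolynomial σ K ⧸ I) →ₗ[MvPolynomial σ K] (MvPolynomial σ K ⧸ I') :=
      Submodule.factor hle
    have hf : Function.Injective f := by
      rw [← LinearMap.ker_eq_bot, LinearMap.ker_eq_bot']
      intro x hx
      obtain ⟨x, rfl⟩ := Ideal.Quotient.mk_surjective x
      have hx' : Ideal.Quotient.mk I (X a ^ s * x) = 0 := hx
      rw [Ideal.Quotient.eq_zero_iff_mem] at *
      exact powId_reg s _ a (by simpa using ha) x (by rwa [mul_comm] at hx')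
    have hg : Function.Surjective g := Submodule.factor_surjective hle
    have hfg : Function.Exact f g := by
      intro x
      obtain ⟨x, rfl⟩ := Ideal.Quotient.mk_surjective x
      have h1 : g (Ideal.Quotient.mk I x) = Ideal.Quotient.mk I' x := rfl
      rw [h1, Ideal.Quotient.eq_zero_iff_mem, powId_insert]
      constructor
      · rintro ⟨y, hy⟩
        refine ⟨Ideal.Quotient.mk I y, ?_⟩
        change Ideal.Quotient.mk I (X a ^ s * y) = _
        symm
        rw [Ideal.Quotient.eq, mul_comm]; exact hy
      · rintro ⟨y, hy⟩
        obtain ⟨y, rfl⟩ := Ideal.Quotient.mk_surjective y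
        change Ideal.Quotient.mk I (X a ^ s * y) = _ at hy
        symm at hy
        rw [Ideal.Quotient.eq, mul_comm] at hy
        exact ⟨y, hy⟩
    have hS := shortExact_of hf hg hfg
    exact hS.hasProjectiveDimensionLT_X₃ (T.card + 1) ih
      (hasProjectiveDimensionLT_of_ge _ (T.card+1) _ (by omega))

lemma LCV.bdd (T : Finset σ) (Q : Ideal (MvPolynomial σ K)) (hQ : Q = Ideal.span (X '' (T : Set σ)))
    (M : Type) [AddCommGroup M] [Module (MvPolynomial σ K) M] (i : ℕ) (hi : T.card < i) :
    LCV Q i M := by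
  obtain ⟨p, rfl⟩ : ∃ p, i = p + 1 := ⟨i - 1, by omega⟩
  unfold LCV
  rw [lc_iff_ext]
  intro s x
  have h1 : powId (K := K) s (T : Set σ) ≤ Q ^ s := by
    unfold powId
    rw [Ideal.span_le]
    rintro _ ⟨_, ⟨j, hj, rfl⟩, rfl⟩
    show monomial (Finsupp.single j s) (1 : K) ∈ Q ^ s
    rw [← X_pow_eq_monomial]
    exact Ideal.pow_mem_pow (hQ ▸ Ideal.subset_span ⟨j, hj, rfl⟩) _
  obtain ⟨t, ht⟩ : ∃ t, Q ^ t ≤ powId (K := K) s (T : Set σ) := by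
    refine Ideal.exists_pow_le_of_le_radical_of_fg ?_ ?_
    · rw [hQ, Ideal.span_le]
      rintro _ ⟨j, hj, rfl⟩
      refine ⟨s, ?_⟩
      rw [X_pow_eq_monomial]
      exact Ideal.subset_span ⟨_, ⟨j, hj, rfl⟩, rfl⟩
    · rw [hQ]
      exact ⟨(T.finite_toSet.image X).toFinset, by simp⟩
  have ht' : Q ^ (max s t) ≤ powId (K := K) s (T : Set σ) := (Ideal.pow_le_pow_right (le_max_right _ _)).trans ht
  refine ⟨max s t, le_max_left _ _, ?_⟩
  let a : ModuleCat.of (MvPolynomial σ K) (MvPolynomial σ K ⧸ Q ^ (max s t)) ⟶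
      ModuleCat.of (MvPolynomial σ K) (MvPolynomial σ K ⧸ powId (K := K) s (T : Set σ)) :=
    ModuleCat.ofHom (Submodule.factor ht')
  let b : ModuleCat.of (MvPolynomial σ K) (MvPolynomial σ K ⧸ powId (K := K) s (T : Set σ)) ⟶
    ModuleCat.of (MvPolynomial σ K) (MvPolynomial σ K ⧸ Q ^ s) :=
    ModuleCat.ofHom (Submodule.factor h1)
  have hab : powTr Q (le_max_left s t) = a ≫ b := by
    refine ModuleCat.hom_ext (LinearMap.ext fun x => ?_)
    obtain ⟨x, rfl⟩ := Submodule.Quotient.mk_surjective _ x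
    rfl
  have := powId_pd (K := K) s T
  rw [hab, ← Abelian.Ext.mk₀_comp_mk₀,
    Abelian.Ext.comp_assoc (h₁₂ := zero_add _) (h₂₃ := zero_add _) (h := by omega),
    ((Abelian.Ext.mk₀ b).comp x (zero_add _)).eq_zero_of_hasProjectiveDimensionLT (T.card+1) (by omega),
    Abelian.Ext.comp_zero]
end bdd


section cd
variable {K : Type} [Field K] {m n : ℕ}

lemma lcv_bdd (M : Type) [AddCommGroup M] [Module (BGS K m n) M] (i : ℕ) (hi : n < i) :
    LCV (idealQ K m n) i M := by
  classical
  refine LCV.bdd (Finset.univ.image (Sum.inr : Fin n → Fin m ⊕ Fin n)) _ ?_ M i ?_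
  · unfold idealQ
    congr 1
    ext f
    simp
  · exact lt_of_le_of_lt (Finset.card_image_le.trans (by simp)) hi

lemma lcv_of_lt {M : Type} [AddCommGroup M] [Module (BGS K m n) M] {i : ℕ}
    (hi : cohDim (BGS K m n) (idealQ K m n) M < i) : LCV (idealQ K m n) i M := by
  by_contra h
  have h' : Nontrivial ((localCohomology (idealQ K m n) i).obj (ModuleCat.of _ M)) :=
    not_subsingleton_iff_nontrivial.1 h
  have : i ≤ cohDim (BGS K m n) (idealQ K m n) M := by
    refine le_csSup ⟨n, ?_⟩ h'
    intro j hj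
    by_contra hlt
    exact not_subsingleton_iff_nontrivial.2 hj (lcv_bdd M j (not_le.1 hlt))
  omega

lemma cd_le {M : Type} [AddCommGroup M] [Module (BGS K m n) M] {c : ℕ}
    (h : ∀ i, c < i → LCV (idealQ K m n) i M) : cohDim (BGS K m n) (idealQ K m n) M ≤ c := by
  refine csSup_le' ?_
  intro j hj
  by_contra hlt
  exact not_subsingleton_iff_nontrivial.2 hj (h j (not_le.1 hlt))

lemma cd_prime_le {N : Type} [AddCommGroup N] [Module (BGS K m n) N] [Module.Finite (BGS K m n) N]
    {p : Ideal (BGS K m n)} (h : Module.annihilator (BGS K m n) N ≤ p) :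
    cohDim (BGS K m n) (idealQ K m n) (BGS K m n ⧸ p) ≤ cohDim (BGS K m n) (idealQ K m n) N := by
  refine cd_le fun i hi => ?_
  refine LCV.support n (fun M _ _ i hi => lcv_bdd M i hi) _ N (fun i hi => lcv_of_lt hi) i hi _ ?_
  rwa [Ideal.annihilator_quotient]

lemma cd_congr {M N : Type} [AddCommGroup M] [Module (BGS K m n) M] [AddCommGroup N]
    [Module (BGS K m n) N] (e : M ≃ₗ[BGS K m n] N) :
    cohDim (BGS K m n) (idealQ K m n) M = cohDim (BGS K m n) (idealQ K m n) N :=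
  le_antisymm (cd_le fun _ hi => (lcv_of_lt hi).equiv e.symm) (cd_le fun _ hi => (lcv_of_lt hi).equiv e)

lemma cd_ext {M N L : Type} [AddCommGroup M] [Module (BGS K m n) M] [AddCommGroup N]
    [Module (BGS K m n) N] [AddCommGroup L] [Module (BGS K m n) L]
    {f : M →ₗ[BGS K m n] N} {g : N →ₗ[BGS K m n] L} (hf : Function.Injective f)
    (hg : Function.Surjective g) (hfg : Function.Exact f g) {c : ℕ}
    (h1 : cohDim (BGS K m n) (idealQ K m n) M < c) (h2 : cohDim (BGS K m n) (idealQ K m n) L < c) :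
    cohDim (BGS K m n) (idealQ K m n) N < c := by
  obtain ⟨c, rfl⟩ : ∃ d, c = d + 1 := ⟨c - 1, by omega⟩
  refine Nat.lt_succ_of_le (cd_le fun i hi => ?_)
  obtain ⟨i, rfl⟩ : ∃ d, i = d + 1 := ⟨i - 1, by omega⟩
  exact LCV.mid hf hg hfg (lcv_of_lt (by omega)) (lcv_of_lt (by omega))
end cd

section graded
variable {K : Type} [Field K] {m n : ℕ} {M : Type} [AddCommGroup M]
    [Module (BGS K m n) M] {ℳ : ℕ × ℕ → AddSubgroup M}

lemma exists_comp (hM : IsBigrading K m n M ℳ) : ∃ (c : ℕ × ℕ → M →+ M) (T : M → Finset (ℕ × ℕ)),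
    (∀ x, x = ∑ d ∈ T x, c d x) ∧ (∀ d x, c d x ∈ ℳ d) ∧
    (∀ d e x, x ∈ ℳ d → c e x = if d = e then x else 0) ∧ (∀ x d, d ∉ T x → c d x = 0) := by
  classical
  let _ := hM.internal.chooseDecomposition
  refine ⟨fun d => (ℳ d).subtype.comp ((DFinsupp.evalAddMonoidHom d).comp
    (DirectSum.decomposeAddEquiv ℳ).toAddMonoidHom), fun x => (DirectSum.decompose ℳ x).support, ?_, ?_, ?_, ?_⟩
  · intro x
    exact (DirectSum.sum_support_decompose ℳ x).symm
  · intro d x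
    exact SetLike.coe_mem _
  · intro d e x hx
    show ((DirectSum.decompose ℳ x) e : M) = _
    split_ifs with h
    · subst h
      exact DirectSum.decompose_of_mem_same ℳ hx
    · exact DirectSum.decompose_of_mem_ne ℳ hx h
  · intro x d hd
    show ((DirectSum.decompose ℳ x) d : M) = _
    have : (DirectSum.decompose ℳ x) d = 0 := by simpa using hd
    rw [this]; rfl

lemma exists_pcomp (f : BGS K m n) : ∃ A : Finset (ℕ × ℕ),
    f = ∑ a ∈ A, weightedHomogeneousComponent (bwt m n) a f := by
  refine ⟨(weightedHomogeneousComponent_finsupp (w := bwt m n) f).toFinset, ?_⟩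
  conv_lhs => rw [← sum_weightedHomogeneousComponent (bwt m n) f]
  rw [finsum_eq_sum _ (weightedHomogeneousComponent_finsupp (w := bwt m n) f)]

lemma bigraded_comp (hM : IsBigrading K m n M ℳ) {N : Submodule (BGS K m n) M}
    (hN : IsBigradedSubmodule K m n ℳ N) (c : ℕ × ℕ → M →+ M) (T : M → Finset (ℕ × ℕ))
    (hc0 : ∀ x, x = ∑ d ∈ T x, c d x) (hc1 : ∀ d x, c d x ∈ ℳ d)
    (hc2 : ∀ d e x, x ∈ ℳ d → c e x = if d = e then x else 0)
    (x : M) (hx : x ∈ N) : ∀ e, c e x ∈ N := by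
  rw [hN] at hx
  induction hx using Submodule.span_induction with
  | mem x h =>
    intro e
    obtain ⟨h1, d, hd⟩ := h
    rw [hc2 d e x hd]
    split_ifs
    exacts [h1, zero_mem _]
  | zero => intro e; simp
  | add x y _ _ hx hy => intro e; rw [map_add]; exact add_mem (hx e) (hy e)
  | smul f x _ hx =>
    intro e
    obtain ⟨A, hA⟩ := exists_pcomp f
    rw [hA, hc0 x, Finset.sum_smul, map_sum]
    refine sum_mem fun a _ => ?_
    rw [Finset.smul_sum, map_sum]
    refine sum_mem fun d _ => ?_
    rw [hc2 (a + d) e _ (hM.smul_mem a d _ _ (weightedHomogeneousComponent_isWeightedHomogeneous a f) (hc1 d x))]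
    split_ifs
    exacts [N.smul_mem _ (hx d), zero_mem _]

lemma graded_prime (hM : IsBigrading K m n M ℳ) {N D : Submodule (BGS K m n) M}
    (hN : IsBigradedSubmodule K m n ℳ N) (hD : IsBigradedSubmodule K m n ℳ D)
    (p : Ideal (BGS K m n)) (hp : p.IsPrime) (x : M) (hx : x ∈ D) (hxp : ∀ s : BGS K m n, s • x ∈ N ↔ s ∈ p) :
    ∃ u ∈ D, ∃ d, u ∈ ℳ d ∧ ∀ s : BGS K m n, s • u ∈ N ↔ s ∈ p := by
  classical
  obtain ⟨c, T, hc0, hc1, hc2, hc3⟩ := exists_comp hM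
  have hcN := bigraded_comp hM hN c T hc0 hc1 hc2
  have hcD := bigraded_comp hM hD c T hc0 hc1 hc2
  -- components of homogeneous multiples
  have hcs : ∀ (a e : ℕ × ℕ) (f : BGS K m n) (x : M), IsWeightedHomogeneous (bwt m n) f a →
      c e (f • x) = ∑ d ∈ T x, if a + d = e then f • c d x else 0 := by
    intro a e f x hf
    conv_lhs => rw [hc0 x, Finset.smul_sum, map_sum]
    refine Finset.sum_congr rfl fun d _ => ?_
    rw [hc2 (a + d) e _ (hM.smul_mem a d _ _ hf (hc1 d x))]
  have hcs' : ∀ (a d : ℕ × ℕ) (f : BGS K m n) (x : M), IsWeightedHomogeneous (bwt m n) f a →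
      c (a + d) (f • x) = f • c d x := by
    intro a d f x hf
    rw [hcs a _ f x hf]
    simp only [add_right_inj, Finset.sum_ite_eq']
    split_ifs with h
    · rfl
    · rw [hc3 x d h, smul_zero]
  let B : M → Finset (ℕ × ℕ) := fun x => (T x).filter fun d => c d x ∉ N
  have hB : ∀ x d, d ∈ B x ↔ c d x ∉ N := by
    intro x d
    simp only [B, Finset.mem_filter, and_iff_right_iff_imp]
    intro h
    by_contra h'
    exact h (by rw [hc3 x d h']; exact zero_mem _)
  obtain ⟨k, hk⟩ : ∃ k, (B x).card = k := ⟨_, rfl⟩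
  induction k using Nat.strong_induction_on generalizing x with
  | _ k ih =>
  by_cases hhom : ∀ f ∈ p, ∀ a, weightedHomogeneousComponent (bwt m n) a f ∈ p
  · -- homogeneous case
    have h1 : ∀ d, ∀ f ∈ p, f • c d x ∈ N := by
      intro d f hf
      obtain ⟨A, hA⟩ := exists_pcomp f
      rw [hA, Finset.sum_smul]
      refine sum_mem fun a _ => ?_
      rw [← hcs' a d _ x (weightedHomogeneousComponent_isWeightedHomogeneous a f)]
      exact hcN _ ((hxp _).2 (hhom f hf a)) _
    have h2 : (T x).inf (fun d => N.colon {c d x}) ≤ p := by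
      intro f hf
      rw [Submodule.mem_finsetInf] at hf
      rw [← hxp, hc0 x, Finset.smul_sum]
      exact sum_mem fun d hd => Submodule.mem_colon_singleton.1 (hf d hd)
    obtain ⟨d, _, hd⟩ := (Ideal.IsPrime.inf_le' hp).1 h2
    exact ⟨c d x, hcD x hx d, d, hc1 d x, fun s => ⟨fun h => hd (Submodule.mem_colon_singleton.2 h), h1 d s⟩⟩
  · push Not at hhom
    obtain ⟨f, hf, a1, ha1⟩ := hhom
    obtain ⟨A, hA⟩ := exists_pcomp f
    set F : ℕ × ℕ → BGS K m n := fun a => weightedHomogeneousComponent (bwt m n) a f with hF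
    have hFh : ∀ a, IsWeightedHomogeneous (bwt m n) (F a) a := fun a =>
      weightedHomogeneousComponent_isWeightedHomogeneous a f
    let A' := A.filter fun a => F a ∉ p
    have hf' : ∑ a ∈ A', F a ∈ p := by
      have h1 := Finset.sum_filter_add_sum_filter_not A (fun a => F a ∉ p) F
      rw [← hA] at h1
      have h2 : ∑ a ∈ A with ¬ (F a ∉ p), F a ∈ p :=
        sum_mem fun a ha => not_not.1 (Finset.mem_filter.1 ha).2
      exact (p.add_mem_iff_left h2).1 (h1.symm ▸ hf)
    have hA'ne : A'.Nonempty := by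
      by_contra hne
      have hall : ∀ a ∈ A, F a ∈ p := by
        intro a ha
        by_contra hap
        exact hne ⟨a, Finset.mem_filter.2 ⟨ha, hap⟩⟩
      apply ha1
      by_cases h : a1 ∈ A
      · exact hall _ h
      · have : F a1 = 0 := by
          show weightedHomogeneousComponent (bwt m n) a1 f = 0
          rw [hA, map_sum]
          refine Finset.sum_eq_zero fun a ha => ?_
          have hne' : a ≠ a1 := fun e => h (e ▸ ha)
          rw [weightedHomogeneousComponent_of_mem (n := a)
            ((mem_weightedHomogeneousSubmodule _ _ _ _).2 (hFh a)), if_neg (Ne.symm hne')]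
        show F a1 ∈ p
        rw [this]; exact zero_mem _
    have hBne : (B x).Nonempty := by
      by_contra hne
      have : x ∈ N := by
        rw [hc0 x]
        refine sum_mem fun d _ => ?_
        by_contra h
        exact hne ⟨d, (hB x d).2 h⟩
      exact hp.ne_top ((Ideal.eq_top_iff_one _).2 ((hxp 1).1 (by rwa [one_smul])))
    obtain ⟨a, ha, hamax⟩ := A'.exists_max_image toLex hA'ne
    obtain ⟨d, hd, hdmax⟩ := (B x).exists_max_image toLex hBne
    have hap : F a ∉ p := (Finset.mem_filter.1 ha).2
    have hkey : F a • c d x ∈ N := by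
      have h1 := hcN _ ((hxp _).2 hf') (a + d)
      rw [Finset.sum_smul, map_sum, ← Finset.add_sum_erase _ _ ha, hcs' a d _ x (hFh a)] at h1
      refine (N.add_mem_iff_left (sum_mem fun b hb => ?_)).1 h1
      rw [hcs b _ _ x (hFh b)]
      refine sum_mem fun e _ => ?_
      split_ifs with hbe
      · by_cases he : e ∈ B x
        · exfalso
          have hb' := Finset.mem_erase.1 hb
          have l1 := lt_of_le_of_ne (hamax b hb'.2) (fun h => hb'.1 (toLex.injective h))
          have l2 := hdmax e he
          have l3 : toLex b + toLex e < toLex a + toLex d := add_lt_add_of_lt_of_le l1 l2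
          rw [← toLex_add, ← toLex_add, hbe] at l3
          exact lt_irrefl _ l3
        · rw [hB, not_not] at he
          exact N.smul_mem _ he
      · exact zero_mem _
    have hBy : B (F a • x) ⊆ ((B x).erase d).image (fun e => a + e) := by
      intro e he
      rw [hB] at he
      have h2 : ∃ d', a + d' = e := by
        by_contra h
        push Not at h
        apply he
        rw [hcs a e _ x (hFh a)]
        refine sum_mem fun d' _ => ?_
        rw [if_neg (h d')]; exact zero_mem _
      obtain ⟨d', rfl⟩ := h2
      rw [hcs' a d' _ x (hFh a)] at he
      refine Finset.mem_image.2 ⟨d', Finset.mem_erase.2 ⟨?_, ?_⟩, rfl⟩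
      · rintro rfl; exact he hkey
      · rw [hB]; exact fun h => he (N.smul_mem _ h)
    have hcard : (B (F a • x)).card < k := by
      rw [← hk]
      exact (Finset.card_le_card hBy).trans_lt (Finset.card_image_le.trans_lt
        (Finset.card_erase_lt_of_mem hd))
    refine ih _ hcard (F a • x) (D.smul_mem _ hx) ?_ rfl
    intro s
    rw [← mul_smul, hxp]
    exact ⟨fun h => (hp.mem_or_mem h).resolve_right hap, fun h => p.mul_mem_right _ h⟩
end graded


section main
variable {K : Type} [Field K] {m n : ℕ} {M : Type} [AddCommGroup M]
    [Module (BGS K m n) M] {ℳ : ℕ × ℕ → AddSubgroup M}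

lemma cd_span (p : Ideal (BGS K m n)) (u : M) (hu : ∀ s : BGS K m n, s • u = 0 ↔ s ∈ p) :
    cohDim (BGS K m n) (idealQ K m n) ↥(Submodule.span (BGS K m n) {u}) =
      cohDim (BGS K m n) (idealQ K m n) (BGS K m n ⧸ p) := by
  have hk : LinearMap.ker (LinearMap.toSpanSingleton (BGS K m n) M u) = p := by
    ext s; simpa using hu s
  subst hk
  refine (cd_congr ?_).symm
  exact (LinearMap.quotKerEquivRange _).trans
    (LinearEquiv.ofEq _ _ (LinearMap.range_toSpanSingleton u))

lemma cd_sup (p : Ideal (BGS K m n)) (N : Submodule (BGS K m n) M) (u : M)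
    (hu : ∀ s : BGS K m n, s • u ∈ N ↔ s ∈ p) {c : ℕ}
    (h1 : cohDim (BGS K m n) (idealQ K m n) N < c)
    (h2 : cohDim (BGS K m n) (idealQ K m n) (BGS K m n ⧸ p) < c) :
    cohDim (BGS K m n) (idealQ K m n) ↥(N ⊔ Submodule.span (BGS K m n) {u}) < c := by
  let f : N →ₗ[BGS K m n] ↥(N ⊔ Submodule.span (BGS K m n) {u}) :=
    Submodule.inclusion le_sup_left
  refine cd_ext (f := f) (g := (LinearMap.range f).mkQ) (Submodule.inclusion_injective _)
    (Submodule.mkQ_surjective _) (LinearMap.exact_iff.2 (Submodule.ker_mkQ _)) h1 ?_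
  let u' : ↥(N ⊔ Submodule.span (BGS K m n) {u}) :=
    ⟨u, le_sup_right (a := N) (Submodule.mem_span_singleton_self u)⟩
  let φ : BGS K m n →ₗ[BGS K m n] (↥(N ⊔ Submodule.span (BGS K m n) {u}) ⧸ LinearMap.range f) :=
    (LinearMap.range f).mkQ ∘ₗ LinearMap.toSpanSingleton (BGS K m n) _ u'
  have hr : ∀ z : ↥(N ⊔ Submodule.span (BGS K m n) {u}), z ∈ LinearMap.range f ↔ (z : M) ∈ N := by
    intro z
    constructor
    · rintro ⟨y, rfl⟩; exact y.2
    · intro h; exact ⟨⟨z, h⟩, rfl⟩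
  have hk : LinearMap.ker φ = p := by
    ext s
    rw [LinearMap.mem_ker, ← hu s]
    show (LinearMap.range f).mkQ (s • u') = 0 ↔ _
    rw [Submodule.mkQ_apply, Submodule.Quotient.mk_eq_zero, hr]
    rfl
  have hs : Function.Surjective φ := by
    intro z
    obtain ⟨⟨z, hz⟩, rfl⟩ := Submodule.mkQ_surjective _ z
    obtain ⟨y, hy, w, hw, rfl⟩ := Submodule.mem_sup.1 hz
    obtain ⟨s, rfl⟩ := Submodule.mem_span_singleton.1 hw
    refine ⟨s, ?_⟩
    show (LinearMap.range f).mkQ (s • u') = _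
    symm
    rw [Submodule.mkQ_apply, Submodule.mkQ_apply, Submodule.Quotient.eq, hr]
    show (y + s • u) - s • u ∈ N
    simpa using hy
  subst hk
  rwa [← cd_congr (φ.quotKerEquivOfSurjective hs)]

lemma bigraded_span {u : M} {d : ℕ × ℕ} (hu : u ∈ ℳ d) :
    IsBigradedSubmodule K m n ℳ (Submodule.span (BGS K m n) {u}) := by
  refine le_antisymm (Submodule.span_mono ?_) (Submodule.span_le.2 fun x hx => hx.1)
  rintro _ rfl
  exact ⟨Submodule.mem_span_singleton_self _, d, hu⟩

lemma bigraded_sup {N N' : Submodule (BGS K m n) M} (h : IsBigradedSubmodule K m n ℳ N)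
    (h' : IsBigradedSubmodule K m n ℳ N') : IsBigradedSubmodule K m n ℳ (N ⊔ N') := by
  refine le_antisymm (sup_le ?_ ?_) (Submodule.span_le.2 fun x hx => hx.1)
  · conv_lhs => rw [h]
    exact Submodule.span_mono fun x hx => ⟨le_sup_left (b := N') hx.1, hx.2⟩
  · conv_lhs => rw [h']
    exact Submodule.span_mono fun x hx => ⟨le_sup_right (a := N) hx.1, hx.2⟩

lemma mem_ass_iff (p : Ideal (BGS K m n)) : p ∈ associatedPrimes (BGS K m n) M ↔
    p.IsPrime ∧ ∃ x : M, ∀ s : BGS K m n, s • x = 0 ↔ s ∈ p := by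
  rw [AssociatedPrimes.mem_iff, isAssociatedPrime_iff]
  refine and_congr_right fun _ => exists_congr fun x => ?_
  rw [SetLike.ext_iff]
  refine forall_congr' fun s => ?_
  rw [Submodule.mem_colon_singleton, Submodule.mem_bot]
  exact Iff.comm

lemma mem_ass_quot_iff (N D : Submodule (BGS K m n) M) (p : Ideal (BGS K m n)) :
    p ∈ associatedPrimes (BGS K m n) (↥D ⧸ (Submodule.comap D.subtype N)) ↔
    p.IsPrime ∧ ∃ x ∈ D, ∀ s : BGS K m n, s • x ∈ N ↔ s ∈ p := by
  rw [mem_ass_iff]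
  refine and_congr_right fun _ => ?_
  constructor
  · rintro ⟨x, hx⟩
    obtain ⟨⟨x, hxD⟩, rfl⟩ := Submodule.mkQ_surjective _ x
    refine ⟨x, hxD, fun s => ?_⟩
    rw [← hx s, ← map_smul, Submodule.mkQ_apply, Submodule.Quotient.mk_eq_zero]
    rfl
  · rintro ⟨x, hxD, hx⟩
    refine ⟨(Submodule.comap D.subtype N).mkQ ⟨x, hxD⟩, fun s => ?_⟩
    rw [← hx s, ← map_smul, Submodule.mkQ_apply, Submodule.Quotient.mk_eq_zero]
    rfl

lemma ann_le_of_mem {N : Submodule (BGS K m n) M} {p : Ideal (BGS K m n)} {x : M} (hx : x ∈ N)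
    (h : ∀ s : BGS K m n, s • x = 0 → s ∈ p) : Module.annihilator (BGS K m n) N ≤ p := by
  intro s hs
  have := Module.mem_annihilator.1 hs ⟨x, hx⟩
  exact h s (congrArg Subtype.val this)

end main

theorem ass_quotient_dimension_filtration
    (K : Type) [Field K] (m n : ℕ)
    (M : Type) [AddCommGroup M] [Module (BGS K m n) M] [Module.Finite (BGS K m n) M]
    (ℳ : ℕ × ℕ → AddSubgroup M) (hM : IsBigrading K m n M ℳ)
    (r : ℕ) (D : Fin (r + 1) → Submodule (BGS K m n) M)
    (hD : IsDimFiltration K m n ℳ r D) (i : Fin r) :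
    associatedPrimes (BGS K m n)
        (↥(D i.succ) ⧸ (Submodule.comap (D i.succ).subtype (D i.castSucc)))
      = {p ∈ associatedPrimes (BGS K m n) M |
          cohDim (BGS K m n) (idealQ K m n) (BGS K m n ⧸ p)
            = cohDim (BGS K m n) (idealQ K m n) ↥(D i.succ)} := by
  have hnoeth : IsNoetherian (BGS K m n) M := isNoetherian_of_isNoetherianRing_of_finite _ _
  have hlt := hD.cd_lt i
  ext p
  rw [Set.mem_setOf_eq, mem_ass_quot_iff, mem_ass_iff]
  constructor
  · rintro ⟨hp, x, hxD, hx⟩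
    have hle : cohDim (BGS K m n) (idealQ K m n) (BGS K m n ⧸ p)
        ≤ cohDim (BGS K m n) (idealQ K m n) ↥(D i.succ) :=
      cd_prime_le (ann_le_of_mem hxD fun s hs => (hx s).1 (by rw [hs]; exact zero_mem _))
    have heq : cohDim (BGS K m n) (idealQ K m n) (BGS K m n ⧸ p)
        = cohDim (BGS K m n) (idealQ K m n) ↥(D i.succ) := by
      by_contra hne
      obtain ⟨u, huD, d, hud, hu⟩ :=
        graded_prime hM (hD.bigraded i.castSucc) (hD.bigraded i.succ) p hp x hxD hx
      have h1 := hD.largest i _ (bigraded_sup (hD.bigraded i.castSucc) (bigraded_span hud))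
        (sup_le (hD.strictMono.monotone (Fin.castSucc_lt_succ).le)
          ((Submodule.span_singleton_le_iff_mem _ _).2 huD))
        (cd_sup p _ u hu hlt (lt_of_le_of_ne hle hne))
      have h2 : u ∈ D i.castSucc :=
        (Submodule.span_singleton_le_iff_mem _ _).1 (le_sup_right.trans h1)
      exact hp.ne_top ((Ideal.eq_top_iff_one _).2 ((hu 1).1 (by rwa [one_smul])))
    refine ⟨⟨hp, ?_⟩, heq⟩
    have hnle : ¬ Module.annihilator (BGS K m n) (D i.castSucc) ≤ p := by
      intro h
      have := cd_prime_le h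
      omega
    obtain ⟨t, ht, htp⟩ := SetLike.not_le_iff_exists.1 hnle
    refine ⟨t • x, fun s => ⟨fun h => ?_, fun h => ?_⟩⟩
    · have : (s * t) • x ∈ D i.castSucc := by rw [mul_smul, h]; exact zero_mem _
      exact (hp.mem_or_mem ((hx _).1 this)).resolve_right htp
    · rw [smul_comm]
      exact congrArg Subtype.val (Module.mem_annihilator.1 ht ⟨s • x, (hx s).2 h⟩)
  · rintro ⟨⟨hp, x, hx⟩, hc⟩
    have htop : IsBigradedSubmodule K m n ℳ (⊤ : Submodule (BGS K m n) M) :=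
      hD.top ▸ hD.bigraded (Fin.last r)
    have hbot : IsBigradedSubmodule K m n ℳ (⊥ : Submodule (BGS K m n) M) :=
      hD.bot ▸ hD.bigraded 0
    obtain ⟨u, -, d, hud, hu⟩ := graded_prime hM hbot htop p hp x trivial
      (fun s => by rw [Submodule.mem_bot]; exact hx s)
    simp only [Submodule.mem_bot] at hu
    have hcd := cd_span p u hu
    have hmono : StrictMono fun j => cohDim (BGS K m n) (idealQ K m n) ↥(D j) :=
      Fin.strictMono_iff_lt_succ.2 hD.cd_lt
    have hmem : ∀ j : Fin (r + 1), i.succ ≤ j → u ∈ D j := by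
      intro j
      induction j using Fin.reverseInduction with
      | last => intro _; rw [hD.top]; trivial
      | cast j ih =>
        intro hij
        have hij' : i.succ < j.succ := hij.trans_lt (Fin.castSucc_lt_succ)
        have h1 := hmono hij'
        refine (Submodule.span_singleton_le_iff_mem _ _).1 (hD.largest j _ (bigraded_span hud)
          ((Submodule.span_singleton_le_iff_mem _ _).2 (ih hij'.le)) ?_)
        rw [hcd, hc]
        exact h1
    refine ⟨hp, u, hmem _ le_rfl, fun s => ⟨fun h => ?_, fun h => ?_⟩⟩
    · by_contra hs
      have := cd_prime_le (ann_le_of_mem (p := p) h fun t ht => by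
        rw [← mul_smul, hu] at ht
        exact (hp.mem_or_mem ht).resolve_right hs)
      omega
    · rw [(hu s).2 h]; exact zero_mem _
end
end

section
/- Let 0 = D_0 ⊊ D_1 ⊊ … ⊊ D_r = M be the dimension filtration of M with respect to Q. Then Ass(M) = ⋃_{i=1}^r Ass(D_i/D_{i-1}). -/
open CategoryTheory MvPolynomial

noncomputable section

section helpers
open CategoryTheory Limits Opposite

variable {R : Type} [CommRing R]

abbrev yF (Y : ModuleCat.{0} R) : ModuleCat.{0} R ⥤ (ModuleCat.{0} R)ᵒᵖ :=
  ((linearYoneda R (ModuleCat.{0} R)).obj Y).rightOp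

instance (Y : ModuleCat.{0} R) : (yF Y).Additive := inferInstance

abbrev yK {X : ModuleCat.{0} R} (P : ProjectiveResolution X) (Y : ModuleCat.{0} R) :
    ChainComplex (ModuleCat.{0} R)ᵒᵖ ℕ :=
  ((yF Y).mapHomologicalComplex _).obj P.complex

/-- a cocycle represents a class -/
def ExtRep {X : ModuleCat.{0} R} (P : ProjectiveResolution X) (Y : ModuleCat.{0} R) (n : ℕ)
    (f : P.complex.X n ⟶ Y) (a : ((Ext R (ModuleCat.{0} R) n).obj (op X)).obj Y) : Prop :=
  ∃ z : ((yK P Y).opcycles n).unop, ((yK P Y).pOpcycles n).unop.hom z = f ∧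
    (P.isoLeftDerivedObj (yF Y) n).hom.unop.hom (((yK P Y).homologyι n).unop.hom z) = a

lemma ExtRep.surj {X : ModuleCat.{0} R} (P : ProjectiveResolution X) (Y : ModuleCat.{0} R) (n : ℕ)
    (a : ((Ext R (ModuleCat.{0} R) n).obj (op X)).obj Y) : ∃ f, ExtRep P Y n f a := by
  obtain ⟨b, hb⟩ := (ModuleCat.epi_iff_surjective
    (P.isoLeftDerivedObj (yF Y) n).hom.unop).1 inferInstance a
  obtain ⟨z, hz⟩ := (ModuleCat.epi_iff_surjective
    ((yK P Y).homologyι n).unop).1 inferInstance b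
  exact ⟨_, z, rfl, by rw [← hb, ← hz]⟩

lemma ExtRep.cocycle {X : ModuleCat.{0} R} {P : ProjectiveResolution X} {Y : ModuleCat.{0} R}
    {n : ℕ} {f} {a} (h : ExtRep P Y n f a) (m : ℕ) : P.complex.d m n ≫ f = 0 := by
  obtain ⟨z, rfl, -⟩ := h
  have := (yK P Y).d_pOpcycles m n
  have h2 := congrArg (fun q => q.unop.hom z) this
  exact h2

lemma ExtRep.exists {X : ModuleCat.{0} R} (P : ProjectiveResolution X) (Y : ModuleCat.{0} R)
    (n : ℕ) (f : P.complex.X n ⟶ Y) (h : P.complex.d (n+1) n ≫ f = 0) : ∃ a, ExtRep P Y n f a := by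
  have ex := (ShortComplex.exact_of_g_is_cokernel (ShortComplex.mk _ _ ((yK P Y).d_pOpcycles (n+1) n))
    ((yK P Y).opcyclesIsCokernel (n+1) n (by simp))).unop
  rw [ShortComplex.moduleCat_exact_iff] at ex
  obtain ⟨z, hz⟩ := ex f h
  exact ⟨_, z, hz, rfl⟩

lemma ExtRep.zero_iff {X : ModuleCat.{0} R} {P : ProjectiveResolution X} {Y : ModuleCat.{0} R}
    {n : ℕ} {f} {a} (h : ExtRep P Y (n+1) f a) :
    a = 0 ↔ ∃ g : P.complex.X n ⟶ Y, P.complex.d (n+1) n ≫ g = f := by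
  obtain ⟨z, rfl, rfl⟩ := h
  have ex := (ShortComplex.exact_of_f_is_kernel
    (ShortComplex.mk _ _ ((yK P Y).homologyι_comp_fromOpcycles (n+1) n))
    ((yK P Y).homologyIsKernel (n+1) n (by simp))).unop
  rw [ShortComplex.moduleCat_exact_iff] at ex
  have inj1 := (ModuleCat.mono_iff_injective
    (P.isoLeftDerivedObj (yF Y) (n+1)).hom.unop).1 inferInstance
  have inj2 := (ModuleCat.mono_iff_injective
    ((yK P Y).pOpcycles (n+1)).unop).1 inferInstance
  have comp := (yK P Y).p_fromOpcycles (n+1) n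
  have comp2 := ((yK P Y).homologyι_comp_fromOpcycles (n+1) n)
  constructor
  · intro h0
    have : (((yK P Y).homologyι (n+1)).unop.hom z) = 0 := inj1 (h0.trans (map_zero (P.isoLeftDerivedObj (yF Y) (n+1)).hom.unop.hom).symm)
    obtain ⟨g, hg⟩ := ex z this
    refine ⟨g, ?_⟩
    have h2 := congrArg (fun q => q.unop.hom g) comp
    rw [← hg]
    exact h2.symm
  · rintro ⟨g, hg⟩
    have h2 := congrArg (fun q => q.unop.hom g) comp
    have : z = ((yK P Y).fromOpcycles (n+1) n).unop.hom g := inj2 (hg.symm.trans h2.symm)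
    rw [this]
    have h3 := congrArg (fun q => q.unop.hom g) comp2
    have h4 := congrArg (P.isoLeftDerivedObj (yF Y) (n+1)).hom.unop.hom h3
    refine h4.trans (map_zero _)

lemma ExtRep.map {X X' : ModuleCat.{0} R} (g : X' ⟶ X) {P : ProjectiveResolution X}
    {P' : ProjectiveResolution X'} (φ : ProjectiveResolution.Hom P' P g) {Y : ModuleCat.{0} R}
    {n : ℕ} {f} {a} (h : ExtRep P Y n f a) :
    ExtRep P' Y n (φ.hom.f n ≫ f) ((((Ext R (ModuleCat.{0} R) n).map g.op).app Y).hom a) := by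
  obtain ⟨z, rfl, rfl⟩ := h
  let ψ : yK P' Y ⟶ yK P Y := ((yF Y).mapHomologicalComplex _).map φ.hom
  refine ⟨(HomologicalComplex.opcyclesMap ψ n).unop.hom z, ?_, ?_⟩
  · have := HomologicalComplex.p_opcyclesMap ψ n
    exact congrArg (fun q => q.unop.hom z) this
  · have h1 := ProjectiveResolution.isoLeftDerivedObj_hom_naturality g P' P φ.hom (by simpa using φ.hom_f_zero_comp_π_f_zero) (yF Y) n
    have h2 := HomologicalComplex.homologyι_naturality ψ n
    have h3 := congrArg (fun q => q.unop.hom (((yK P Y).homologyι n).unop.hom z)) h1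
    have h4 := congrArg (fun q => (P'.isoLeftDerivedObj (yF Y) n).hom.unop.hom (q.unop.hom z)) h2
    exact h4.symm.trans h3.symm

/-- the transition maps -/
def qmap (J : Ideal R) {s t : ℕ} (h : s ≤ t) :
    ModuleCat.of R (R ⧸ J ^ t) ⟶ ModuleCat.of R (R ⧸ J ^ s) :=
  ModuleCat.ofHom (Submodule.mapQ _ _ LinearMap.id (Ideal.pow_le_pow_right h))

lemma qmap_comp (J : Ideal R) {s t v : ℕ} (h : s ≤ t) (h' : t ≤ v) :
    qmap J h' ≫ qmap J h = qmap J (h.trans h') := by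
  ext
  rfl

/-- vanishing in the colimit -/
def Dies (J : Ideal R) (n : ℕ) (Y : ModuleCat.{0} R) : Prop :=
  ∀ (t : ℕ) (α : Abelian.Ext (ModuleCat.of R (R ⧸ J ^ t)) Y n),
    ∃ (t' : ℕ) (h : t ≤ t'), (Abelian.Ext.mk₀ (qmap J h)).comp α (zero_add _) = 0

lemma dies_iff_old (J : Ideal R) (n : ℕ) (Y : ModuleCat.{0} R) :
    Dies J (n+1) Y ↔ ∀ (t : ℕ) (a : ((Ext R (ModuleCat.{0} R) (n+1)).obj (op (ModuleCat.of R (R ⧸ J ^ t)))).obj Y),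
    ∃ (t' : ℕ) (h : t ≤ t'), (((Ext R (ModuleCat.{0} R) (n+1)).map (qmap J h).op).app Y).hom a = 0 := by
  have key : ∀ (t t' : ℕ) (h : t ≤ t') (α : Abelian.Ext (ModuleCat.of R (R ⧸ J ^ t)) Y (n+1))
    (a : ((Ext R (ModuleCat.{0} R) (n+1)).obj (op (ModuleCat.of R (R ⧸ J ^ t)))).obj Y)
    (f) (hf : (projectiveResolution (ModuleCat.of R (R ⧸ J ^ t))).complex.d (n+1+1) (n+1) ≫ f = 0),
    ProjectiveResolution.extMk _ f (n+1+1) rfl hf = α → ExtRep _ Y _ f a →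
    ((Abelian.Ext.mk₀ (qmap J h)).comp α (zero_add _) = 0 ↔
      (((Ext R (ModuleCat.{0} R) (n+1)).map (qmap J h).op).app Y).hom a = 0) := by
    intro t t' h α a f hf hα ha
    let φ : ProjectiveResolution.Hom (projectiveResolution (ModuleCat.of R (R ⧸ J ^ t')))
      (projectiveResolution (ModuleCat.of R (R ⧸ J ^ t))) (qmap J h) :=
      ⟨ProjectiveResolution.lift (qmap J h) _ _, (ProjectiveResolution.lift_commutes_zero _ _ _).trans (by simp)⟩
    rw [← hα, ProjectiveResolution.mk₀_comp_extMk f _ rfl hf φ,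
      ProjectiveResolution.extMk_eq_zero_iff _ _ _ _ _ n rfl, (ha.map _ φ).zero_iff]
  constructor
  · intro H t a
    obtain ⟨f, hf⟩ := ExtRep.surj (projectiveResolution _) Y (n+1) a
    obtain ⟨t', h, h0⟩ := H t (ProjectiveResolution.extMk _ f (n+1+1) rfl (hf.cocycle _))
    exact ⟨t', h, (key t t' h _ a f _ rfl hf).1 h0⟩
  · intro H t α
    obtain ⟨f, hf, hα⟩ := (projectiveResolution (ModuleCat.of R (R ⧸ J ^ t))).extMk_surjective α (n+1+1) rfl
    obtain ⟨a, ha⟩ := ExtRep.exists _ Y _ f hf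
    obtain ⟨t', h, h0⟩ := H t a
    exact ⟨t', h, (key t t' h α a f hf hα ha).2 h0⟩

lemma dies_iff (J : Ideal R) (n : ℕ) (Y : ModuleCat.{0} R) :
    Dies J (n+1) Y ↔ ¬ Nontrivial ((localCohomology J (n+1)).obj Y) := by
  rw [dies_iff_old, not_nontrivial_iff_subsingleton]
  let F := localCohomology.diagram (localCohomology.idealPowersDiagram J) (n+1)
  let e : (localCohomology J (n+1)).obj Y ≅ colimit (F ⋙ (evaluation _ _).obj Y) :=
    (colimitObjIsoColimitCompEvaluation F Y)
  have e2 := e.toLinearEquiv.toEquiv.subsingleton_congr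
  rw [e2]
  let G : ℕᵒᵖᵒᵖ ⥤ ModuleCat.{0} R := F ⋙ (evaluation _ _).obj Y
  change _ ↔ Subsingleton (colimit G : ModuleCat.{0} R)
  constructor
  · intro H
    refine subsingleton_of_forall_eq 0 fun x => ?_
    obtain ⟨j, y, rfl⟩ := Concrete.colimit_exists_rep G x
    obtain ⟨t', h, h0⟩ := H j.unop.unop y
    let w : j ⟶ op (op t') := (homOfLE h).op.op
    rw [← colimit.w G w]
    have : G.map w y = 0 := h0
    rw [ConcreteCategory.comp_apply, this, map_zero]
  · intro H t a
    obtain ⟨j', i, h⟩ := Concrete.colimit_rep_eq_zero R G (op (op t)) a (Subsingleton.elim _ _)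
    exact ⟨j'.unop.unop, i.unop.unop.le, h⟩

lemma Dies.of_iso {J : Ideal R} {n : ℕ} {Y Y' : ModuleCat.{0} R} (e : Y ≅ Y') (h : Dies J n Y) :
    Dies J n Y' := by
  intro t α
  obtain ⟨t', ht, h0⟩ := h t (α.comp (Abelian.Ext.mk₀ e.inv) (add_zero _))
  refine ⟨t', ht, ?_⟩
  have h1 := congrArg (fun x => x.comp (Abelian.Ext.mk₀ e.hom) (add_zero _)) h0
  simpa using h1

lemma Dies.of_linearEquiv {J : Ideal R} {n : ℕ} {Y Y' : Type} [AddCommGroup Y] [Module R Y]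
    [AddCommGroup Y'] [Module R Y'] (e : Y ≃ₗ[R] Y') (h : Dies J n (ModuleCat.of R Y)) :
    Dies J n (ModuleCat.of R Y') := h.of_iso e.toModuleIso

lemma Dies.of_subsingleton (J : Ideal R) (n : ℕ) (Y : Type) [AddCommGroup Y] [Module R Y]
    [Subsingleton Y] : Dies J n (ModuleCat.of R Y) := by
  intro t α
  refine ⟨t, le_rfl, ?_⟩
  have : α = α.comp (Abelian.Ext.mk₀ (0 : ModuleCat.of R Y ⟶ ModuleCat.of R Y)) (add_zero _) := by
    rw [show (0 : ModuleCat.of R Y ⟶ ModuleCat.of R Y) = 𝟙 _ from by ext; exact Subsingleton.elim _ _]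
    simp
  rw [this]; simp

lemma Dies.middle {J : Ideal R} {n : ℕ} {S : ShortComplex (ModuleCat.{0} R)} (hS : S.ShortExact)
    (h1 : Dies J n S.X₁) (h3 : Dies J n S.X₃) : Dies J n S.X₂ := by
  intro t α
  obtain ⟨t', ht, h0⟩ := h3 t (α.comp (Abelian.Ext.mk₀ S.g) (add_zero _))
  rw [← Abelian.Ext.comp_assoc _ _ _ (zero_add _) (add_zero _) (by simp)] at h0
  obtain ⟨β, hβ⟩ := Abelian.Ext.covariant_sequence_exact₂ _ hS _ h0
  obtain ⟨t'', ht', h0'⟩ := h1 t' β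
  refine ⟨t'', ht.trans ht', ?_⟩
  rw [← qmap_comp J ht ht', ← Abelian.Ext.mk₀_comp_mk₀,
    Abelian.Ext.comp_assoc _ _ _ (zero_add _) (zero_add _) (by simp), ← hβ,
    ← Abelian.Ext.comp_assoc _ _ _ (zero_add _) (add_zero _) (by simp), h0']
  simp

lemma Dies.right {J : Ideal R} {n : ℕ} {S : ShortComplex (ModuleCat.{0} R)} (hS : S.ShortExact)
    (h2 : Dies J n S.X₂) (h1 : Dies J (n+1) S.X₁) : Dies J n S.X₃ := by
  intro t α
  obtain ⟨t', ht, h0⟩ := h1 t (α.comp hS.extClass rfl)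
  rw [← Abelian.Ext.comp_assoc _ _ _ (zero_add _) rfl (by simp)] at h0
  obtain ⟨β, hβ⟩ := Abelian.Ext.covariant_sequence_exact₃ _ hS _ _ h0
  obtain ⟨t'', ht', h0'⟩ := h2 t' β
  refine ⟨t'', ht.trans ht', ?_⟩
  rw [← qmap_comp J ht ht', ← Abelian.Ext.mk₀_comp_mk₀,
    Abelian.Ext.comp_assoc _ _ _ (zero_add _) (zero_add _) (by simp), ← hβ,
    ← Abelian.Ext.comp_assoc _ _ _ (zero_add _) (add_zero _) (by simp), h0']
  simp

lemma shortExact_of_s1 {A B C : Type} [AddCommGroup A] [Module R A] [AddCommGroup B] [Module R B]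
    [AddCommGroup C] [Module R C] (f : A →ₗ[R] B) (g : B →ₗ[R] C) (hf : Function.Injective f)
    (hg : Function.Surjective g) (h : Function.Exact f g) :
    (ShortComplex.mk (ModuleCat.ofHom f) (ModuleCat.ofHom g)
      (by ext x; exact h.apply_apply_eq_zero x)).ShortExact where
  exact := by
    rw [ShortComplex.moduleCat_exact_iff]
    exact fun x hx => (h x).1 hx
  mono_f := (ModuleCat.mono_iff_injective _).2 hf
  epi_g := (ModuleCat.epi_iff_surjective _).2 hg

lemma Dies.mid {J : Ideal R} {n : ℕ} {A B C : Type} [AddCommGroup A] [Module R A]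
    [AddCommGroup B] [Module R B]
    [AddCommGroup C] [Module R C] (f : A →ₗ[R] B) (g : B →ₗ[R] C) (hf : Function.Injective f)
    (hg : Function.Surjective g) (h : Function.Exact f g)
    (h1 : Dies J n (ModuleCat.of R A)) (h3 : Dies J n (ModuleCat.of R C)) :
    Dies J n (ModuleCat.of R B) := Dies.middle (shortExact_of_s1 f g hf hg h) h1 h3

lemma Dies.rt {J : Ideal R} {n : ℕ} {A B C : Type} [AddCommGroup A] [Module R A]
    [AddCommGroup B] [Module R B]
    [AddCommGroup C] [Module R C] (f : A →ₗ[R] B) (g : B →ₗ[R] C) (hf : Function.Injective f)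
    (hg : Function.Surjective g) (h : Function.Exact f g)
    (h2 : Dies J n (ModuleCat.of R B)) (h1 : Dies J (n+1) (ModuleCat.of R A)) :
    Dies J n (ModuleCat.of R C) := Dies.right (shortExact_of_s1 f g hf hg h) h2 h1

/-- bounded projective dimension of a cofinal family gives vanishing -/
lemma Dies.of_pd {J : Ideal R} {N : ℕ} (H : ∀ t, ∃ (I : Ideal R) (t' : ℕ), I ≤ J ^ t ∧ J ^ t' ≤ I ∧
    HasProjectiveDimensionLT (ModuleCat.of R (R ⧸ I)) N) {n : ℕ} (hn : N ≤ n)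
    (Y : ModuleCat.{0} R) : Dies J n Y := by
  intro t α
  obtain ⟨I, t', h1, h2, h3⟩ := H t
  have h2' : J ^ (max t t') ≤ I := (Ideal.pow_le_pow_right (le_max_right _ _)).trans h2
  refine ⟨max t t', le_max_left _ _, ?_⟩
  let f : ModuleCat.of R (R ⧸ I) ⟶ ModuleCat.of R (R ⧸ J ^ t) :=
    ModuleCat.ofHom (Submodule.mapQ _ _ LinearMap.id h1)
  let g : ModuleCat.of R (R ⧸ J ^ (max t t')) ⟶ ModuleCat.of R (R ⧸ I) :=
    ModuleCat.ofHom (Submodule.mapQ _ _ LinearMap.id h2')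
  have : qmap J (le_max_left t t') = g ≫ f := by ext; rfl
  rw [this, ← Abelian.Ext.mk₀_comp_mk₀,
    Abelian.Ext.comp_assoc _ _ _ (zero_add _) (zero_add _) (by simp),
    Abelian.Ext.eq_zero_of_hasProjectiveDimensionLT ((Abelian.Ext.mk₀ f).comp α (zero_add _)) N hn]
  simp

lemma pd_quot (I : Ideal R) (x : R) (N : ℕ) (hreg : ∀ y, x * y ∈ I → y ∈ I)
    (h : HasProjectiveDimensionLT (ModuleCat.of R (R ⧸ I)) N) :
    HasProjectiveDimensionLT (ModuleCat.of R (R ⧸ (I ⊔ Ideal.span {x}))) (N+1) := by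
  let f : (R ⧸ I) →ₗ[R] (R ⧸ I) := LinearMap.lsmul R _ x
  let g : (R ⧸ I) →ₗ[R] (R ⧸ (I ⊔ Ideal.span {x})) := Submodule.mapQ _ _ LinearMap.id le_sup_left
  refine (shortExact_of_s1 f g ?_ ?_ ?_).hasProjectiveDimensionLT_X₃ N h ?_
  · rw [injective_iff_map_eq_zero]
    intro a ha
    obtain ⟨a, rfl⟩ := Ideal.Quotient.mk_surjective a
    have : Ideal.Quotient.mk I (x * a) = 0 := ha
    rw [Ideal.Quotient.eq_zero_iff_mem] at this ⊢
    exact hreg _ this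
  · intro a
    obtain ⟨a, rfl⟩ := Ideal.Quotient.mk_surjective a
    exact ⟨Ideal.Quotient.mk I a, rfl⟩
  · intro a
    obtain ⟨a, rfl⟩ := Ideal.Quotient.mk_surjective a
    have : g (Ideal.Quotient.mk I a) = Ideal.Quotient.mk _ a := rfl
    rw [this, Ideal.Quotient.eq_zero_iff_mem, Submodule.mem_sup]
    constructor
    · rintro ⟨y, hy, z, hz, rfl⟩
      obtain ⟨w, rfl⟩ := Ideal.mem_span_singleton'.1 hz
      refine ⟨Ideal.Quotient.mk I w, ?_⟩
      change Ideal.Quotient.mk I (x * w) = _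
      rw [Ideal.Quotient.eq]
      have : x * w - (y + w * x) = - y := by ring
      rw [this]; exact neg_mem hy
    · rintro ⟨w, hw⟩
      obtain ⟨w, rfl⟩ := Ideal.Quotient.mk_surjective w
      change Ideal.Quotient.mk I (x * w) = _ at hw
      rw [Ideal.Quotient.eq] at hw
      exact ⟨a - x * w, by simpa using neg_mem hw, x * w, Ideal.mul_mem_right _ _ (Ideal.mem_span_singleton_self x), by ring⟩
  · exact hasProjectiveDimensionLT_of_ge _ N (N+1) (by omega)

section mono
open MvPolynomial
variable {σ : Type} {K : Type} [Field K]

/-- the ideal generated by `t`-th powers of the variables in `s` -/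
def powIdeal (K : Type) [Field K] (s : Set σ) (t : ℕ) : Ideal (MvPolynomial σ K) :=
  Ideal.span ((fun v => monomial v (1 : K)) '' ((fun i => Finsupp.single i t) '' s))

lemma powIdeal_pd [DecidableEq σ] (s : Finset σ) (t : ℕ) :
    HasProjectiveDimensionLT (ModuleCat.of (MvPolynomial σ K)
      (MvPolynomial σ K ⧸ powIdeal K (s : Set σ) t)) (s.card + 1) := by
  induction s using Finset.induction_on with
  | empty =>
    have : powIdeal K ((∅ : Finset σ) : Set σ) t = ⊥ := by simp [powIdeal]
    rw [this]
    let e : MvPolynomial σ K ≃ₗ[MvPolynomial σ K] (MvPolynomial σ K ⧸ (⊥ : Ideal (MvPolynomial σ K))) :=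
      (Submodule.quotEquivOfEqBot ⊥ rfl).symm
    have : Projective (ModuleCat.of (MvPolynomial σ K) (MvPolynomial σ K)) :=
      (IsProjective.iff_projective _ ).1 inferInstance
    exact hasProjectiveDimensionLT_of_iso e.toModuleIso 1
  | insert a s ha ih =>
    rw [Finset.card_insert_of_notMem ha]
    have : powIdeal K ((insert a s : Finset σ) : Set σ) t =
        powIdeal K (s : Set σ) t ⊔ Ideal.span {monomial (Finsupp.single a t) (1:K)} := by
      simp only [powIdeal, Finset.coe_insert, Set.image_insert_eq]
      rw [Ideal.span_insert, sup_comm]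
    rw [this]
    refine pd_quot _ _ _ ?_ ih
    intro y hy
    unfold powIdeal at hy ⊢
    rw [mem_ideal_span_monomial_image] at hy ⊢
    intro v hv
    obtain ⟨_, ⟨i, hi, rfl⟩, hle⟩ := hy (Finsupp.single a t + v) (by
      rw [mem_support_iff] at hv ⊢
      rw [coeff_monomial_mul]; simpa using hv)
    refine ⟨_, ⟨i, hi, rfl⟩, ?_⟩
    have hne : a ≠ i := by rintro rfl; exact ha hi
    have := hle i
    simp only [Finsupp.single_le_iff, Finsupp.add_apply] at this ⊢
    simpa [Finsupp.single_eq_of_ne hne, Finsupp.single_eq_of_ne hne.symm] using this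

lemma dies_big [Finite σ] [DecidableEq σ] (s : Finset σ) {n : ℕ} (hn : s.card + 1 ≤ n)
    (Y : ModuleCat.{0} (MvPolynomial σ K)) :
    Dies (Ideal.span (X '' (s : Set σ)) : Ideal (MvPolynomial σ K)) n Y := by
  refine Dies.of_pd (fun t => ?_) hn Y
  have hX : ∀ i : σ, (monomial (Finsupp.single i t) (1:K)) = X i ^ t := fun i => by
    rw [X_pow_eq_monomial]
  have h : (Ideal.span (X '' (s : Set σ)) : Ideal (MvPolynomial σ K)) ≤
      (powIdeal K (s : Set σ) t).radical := by
    rw [Ideal.span_le]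
    rintro _ ⟨i, hi, rfl⟩
    refine ⟨t, ?_⟩
    rw [← hX]
    exact Ideal.subset_span ⟨_, ⟨i, hi, rfl⟩, rfl⟩
  obtain ⟨t', ht'⟩ := Ideal.exists_pow_le_of_le_radical_of_fg h
    (IsNoetherian.noetherian _)
  refine ⟨powIdeal K (s : Set σ) t, t', ?_, ht', powIdeal_pd s t⟩
  unfold powIdeal
  rw [Ideal.span_le]
  rintro _ ⟨_, ⟨i, hi, rfl⟩, rfl⟩
  simp only [hX]
  exact Ideal.pow_mem_pow (Ideal.subset_span (Set.mem_image_of_mem _ hi)) t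
end mono

section support
open TensorProduct

lemma exists_nonzero_map (L : Type) [AddCommGroup L] [Module R L] [Module.Finite R L]
    (p : PrimeSpectrum R) (hp : Module.annihilator R L ≤ p.asIdeal) :
    ∃ f : L →ₗ[R] (R ⧸ p.asIdeal), f ≠ 0 := by
  classical
  have h1 : p ∈ Module.support R L := Module.mem_support_iff_of_finite.2 hp
  rw [Module.mem_support_iff_nontrivial_residueField_tensorProduct] at h1
  let κ := p.asIdeal.ResidueField
  obtain ⟨v, hv⟩ := exists_ne (0 : κ ⊗[R] L)
  obtain ⟨ψ, hψ⟩ : ∃ ψ : Module.Dual κ (κ ⊗[R] L), ψ v ≠ 0 := by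
    by_contra! h
    exact hv ((Module.forall_dual_apply_eq_zero_iff κ v).1 h)
  let g : L →ₗ[R] κ := (ψ.restrictScalars R).comp (TensorProduct.mk R κ L 1)
  have hg : g ≠ 0 := by
    intro h0
    apply hψ
    have : ψ = 0 := by
      ext l
      exact LinearMap.congr_fun h0 l
    rw [this]; rfl
  obtain ⟨s, hs⟩ := (Module.finite_def (R := R) (M := L)).1 inferInstance
  obtain ⟨b, hb⟩ := IsLocalization.exist_integer_multiples_of_finset
    (nonZeroDivisors (R ⧸ p.asIdeal)) (S := κ) (s.image g)
  let a : (R ⧸ p.asIdeal) →ₗ[R] κ := (Algebra.linearMap (R ⧸ p.asIdeal) κ).restrictScalars R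
  have ha : Function.Injective a := IsFractionRing.injective (R ⧸ p.asIdeal) κ
  let g' : L →ₗ[R] κ := (LinearMap.mulLeft R (algebraMap (R ⧸ p.asIdeal) κ b)).comp g
  have hr : ∀ l, g' l ∈ LinearMap.range a := by
    have : (⊤ : Submodule R L) ≤ (LinearMap.range a).comap g' := by
      rw [← hs, Submodule.span_le]
      intro l hl
      obtain ⟨c, hc⟩ := hb (g l) (Finset.mem_image_of_mem _ hl)
      refine ⟨c, ?_⟩
      change algebraMap _ κ c = algebraMap (R ⧸ p.asIdeal) κ b * g l
      rw [hc]
      exact Algebra.smul_def _ _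
    exact fun l => this trivial
  have hb0 : algebraMap (R ⧸ p.asIdeal) κ b ≠ 0 :=
    IsFractionRing.to_map_ne_zero_of_mem_nonZeroDivisors b.2
  refine ⟨(LinearEquiv.ofInjective a ha).symm.toLinearMap.comp (g'.codRestrict _ hr), ?_⟩
  intro h0
  apply hg
  ext l
  have := LinearMap.congr_fun h0 l
  simp only [LinearMap.comp_apply, LinearEquiv.coe_coe, LinearMap.zero_apply,
    LinearEquiv.map_eq_zero_iff] at this
  have h2 : algebraMap (R ⧸ p.asIdeal) κ b * g l = 0 := congrArg Subtype.val this
  exact (mul_eq_zero.1 h2).resolve_left hb0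

lemma dies_support [IsNoetherianRing R] (J : Ideal R) (L : Type) [AddCommGroup L] [Module R L]
    [Module.Finite R L] (b c : ℕ) (hb : ∀ n, b ≤ n → ∀ Y : ModuleCat.{0} R, Dies J n Y)
    (hL : ∀ n, c < n → Dies J n (ModuleCat.of R L)) (k : ℕ) : ∀ n, b ≤ n + k → c < n →
    ∀ (N : Type) [AddCommGroup N] [Module R N] [Module.Finite R N],
      Module.annihilator R L ≤ (Module.annihilator R N).radical → Dies J n (ModuleCat.of R N) := by
  induction k with
  | zero => intro n hn _ N _ _ _ _; exact hb n hn _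
  | succ k ih =>
    intro n hn hc
    have main : ∀ I : Ideal R, ∀ (N : Type) [AddCommGroup N] [Module R N] [Module.Finite R N],
      I ≤ Module.annihilator R N →
      Module.annihilator R L ≤ (Module.annihilator R N).radical →
      Dies J n (ModuleCat.of R N) := by
      intro I
      induction I using WellFoundedGT.induction with
      | ind I IH =>
      intro N _ _ hN
      induction hN using IsNoetherianRing.induction_on_isQuotientEquivQuotientPrime R with
      | subsingleton N => intros; exact Dies.of_subsingleton J n N
      | exact N₁ N₂ N₃ f g hf hg hfg h₁ h₃ =>
        intro hI hr
        have e1 := f.annihilator_le_of_injective hf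
        have e3 := g.annihilator_le_of_surjective hg
        exact Dies.mid f g hf hg hfg (h₁ (hI.trans e1) (hr.trans (Ideal.radical_mono e1)))
          (h₃ (hI.trans e3) (hr.trans (Ideal.radical_mono e3)))
      | quotient N p e =>
        intro hI hr
        have hann : Module.annihilator R N = p.asIdeal := by
          rw [e.annihilator_eq, Ideal.annihilator_quotient]
        rw [hann] at hI hr
        rw [p.2.radical] at hr
        obtain ⟨f, hf⟩ := exists_nonzero_map L p hr
        have hker : Dies J (n+1) (ModuleCat.of R (LinearMap.ker f)) := by
          refine ih (n+1) (by omega) (by omega) _ ?_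
          exact ((LinearMap.ker f).subtype.annihilator_le_of_injective
            Subtype.val_injective).trans Ideal.le_radical
        have hran : Dies J n (ModuleCat.of R (LinearMap.range f)) :=
          Dies.rt (LinearMap.ker f).subtype f.rangeRestrict Subtype.val_injective
            f.surjective_rangeRestrict
            (by intro x; simp [← LinearMap.mem_ker]) (hL n hc) hker
        refine Dies.of_linearEquiv e.symm ?_
        refine Dies.mid (LinearMap.range f).subtype (LinearMap.range f).mkQ Subtype.val_injective
          (Submodule.mkQ_surjective _) (by intro x; simp) hran ?_
        have hle : p.asIdeal ≤ Module.annihilator R ((R ⧸ p.asIdeal) ⧸ LinearMap.range f) := by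
          have := (LinearMap.range f).mkQ.annihilator_le_of_surjective (Submodule.mkQ_surjective _)
          rwa [Ideal.annihilator_quotient] at this
        refine IH _ ?_ _ le_rfl ((hr.trans hle).trans Ideal.le_radical)
        refine lt_of_le_of_ne (hI.trans hle) ?_
        rintro hEq
        have hEq2 : p.asIdeal = Module.annihilator R ((R ⧸ p.asIdeal) ⧸ LinearMap.range f) :=
          le_antisymm hle (hEq ▸ hI)
        apply hf
        ext l
        obtain ⟨r, hr⟩ := Ideal.Quotient.mk_surjective (f l)
        have : r ∈ Module.annihilator R ((R ⧸ p.asIdeal) ⧸ LinearMap.range f) := by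
          rw [Module.mem_annihilator]
          intro x
          obtain ⟨x, rfl⟩ := Submodule.mkQ_surjective _ x
          obtain ⟨x, rfl⟩ := Ideal.Quotient.mk_surjective x
          rw [← map_smul]
          simp only [Submodule.mkQ_apply, Submodule.Quotient.mk_eq_zero]
          refine ⟨x • l, ?_⟩
          rw [map_smul, ← hr]
          change Ideal.Quotient.mk _ (x * r) = Ideal.Quotient.mk _ (r * x)
          rw [mul_comm]
        rw [← hEq2] at this
        rw [← hr]
        exact Ideal.Quotient.eq_zero_iff_mem.2 this
    intro N _ _ _ h
    exact main ⊥ N bot_le h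

lemma cohDim_lemma [IsNoetherianRing R] (J : Ideal R) (L N : Type) [AddCommGroup L] [Module R L]
    [Module.Finite R L] [AddCommGroup N] [Module R N] [Module.Finite R N]
    (b : ℕ) (hb : ∀ n, b ≤ n → ∀ Y : ModuleCat.{0} R, Dies J n Y)
    (h : Module.annihilator R L ≤ (Module.annihilator R N).radical) :
    cohDim R J N ≤ cohDim R J L := by
  have hL : ∀ n, cohDim R J L < n → Dies J n (ModuleCat.of R L) := by
    intro n hn
    obtain ⟨n, rfl⟩ : ∃ k, n = k + 1 := ⟨n - 1, by omega⟩
    rw [dies_iff]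
    intro hnt
    refine absurd (le_csSup ⟨b, ?_⟩ hnt) (not_le.2 hn)
    rintro i (hi : Nontrivial _)
    by_contra! hlt
    obtain ⟨i, rfl⟩ : ∃ k, i = k + 1 := ⟨i - 1, by omega⟩
    exact (dies_iff J i _).1 (hb _ hlt.le _) hi
  refine csSup_le' ?_
  rintro i (hi : Nontrivial _)
  by_contra! hlt
  obtain ⟨i, rfl⟩ : ∃ k, i = k + 1 := ⟨i - 1, by omega⟩
  exact (dies_iff J i _).1 (dies_support J L b _ hb hL b (i+1) (by omega) hlt N h) hi
end support

section graded
open MvPolynomial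
variable {K : Type} [Field K] {m n : ℕ} {M : Type} [AddCommGroup M] [Module (BGS K m n) M]
  {ℳ : ℕ × ℕ → AddSubgroup M}

/-- the homogeneous component projections of a bigraded module -/
lemma exists_proj (hM : IsBigrading K m n M ℳ) :
    ∃ π : ℕ × ℕ → M →+ M, (∀ e x, π e x ∈ ℳ e) ∧ (∀ e x, x ∈ ℳ e → π e x = x) ∧
      (∀ e e' x, x ∈ ℳ e → e ≠ e' → π e' x = 0) ∧
      (∀ x, ∃ s : Finset (ℕ × ℕ), ∑ e ∈ s, π e x = x) := by
  classical
  letI := hM.internal.chooseDecomposition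
  refine ⟨fun e => AddMonoidHom.mk' (fun x => (DirectSum.decompose ℳ x e : M)) ?_, ?_, ?_, ?_, ?_⟩
  · intro a b
    rw [DirectSum.decompose_add]
    rfl
  · intro e x
    exact (DirectSum.decompose ℳ x e).2
  · intro e x hx
    exact DirectSum.decompose_of_mem_same ℳ hx
  · intro e e' x hx hne
    exact DirectSum.decompose_of_mem_ne ℳ hx hne
  · intro x
    exact ⟨_, DirectSum.sum_support_decompose ℳ x⟩

variable {π : ℕ × ℕ → M →+ M}

lemma proj_smul (hM : IsBigrading K m n M ℳ)
    (h1 : ∀ e x, π e x ∈ ℳ e) (h2 : ∀ e x, x ∈ ℳ e → π e x = x)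
    (h3 : ∀ e e' x, x ∈ ℳ e → e ≠ e' → π e' x = 0)
    (h4 : ∀ x, ∃ s : Finset (ℕ × ℕ), ∑ e ∈ s, π e x = x)
    (s : BGS K m n) (d e : ℕ × ℕ) (hs : IsWeightedHomogeneous (bwt m n) s d) (x : M) :
    π (d + e) (s • x) = s • π e x := by
  have key : ∀ e' y, y ∈ ℳ e' → π (d + e) (s • y) = s • π e y := by
    intro e' y hy
    by_cases he : e' = e
    · subst he
      rw [h2 _ _ hy, h2 _ _ (hM.smul_mem d e' s y hs hy)]
    · rw [h3 _ _ _ hy he, h3 _ _ _ (hM.smul_mem d e' s y hs hy) (by simpa using he), smul_zero]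
  obtain ⟨t, ht⟩ := h4 x
  rw [← ht, Finset.smul_sum, map_sum, map_sum, Finset.smul_sum]
  exact Finset.sum_congr rfl fun e' _ => key e' _ (h1 e' x)

lemma proj_smul' (hM : IsBigrading K m n M ℳ)
    (h2 : ∀ e x, x ∈ ℳ e → π e x = x)
    (h3 : ∀ e e' x, x ∈ ℳ e → e ≠ e' → π e' x = 0)
    (f : BGS K m n) (d e : ℕ × ℕ) (x : M) (hx : x ∈ ℳ e) :
    π (d + e) (f • x) = weightedHomogeneousComponent (bwt m n) d f • x := by
  induction f using MvPolynomial.induction_on' with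
  | monomial u c =>
    have hh : IsWeightedHomogeneous (bwt m n) (monomial u c) (Finsupp.weight (bwt m n) u) :=
      isWeightedHomogeneous_monomial _ _ _ rfl
    have hm := hM.smul_mem _ e _ x hh hx
    by_cases hd : d = Finsupp.weight (bwt m n) u
    · subst hd
      rw [hh.weightedHomogeneousComponent_same, h2 _ _ hm]
    · rw [hh.weightedHomogeneousComponent_ne _ hd, zero_smul, h3 _ _ _ hm]
      simpa using fun h => hd h.symm
  | add p q hp hq => rw [add_smul, map_add, map_add, add_smul, hp, hq]

lemma proj_mem (hM : IsBigrading K m n M ℳ)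
    (h1 : ∀ e x, π e x ∈ ℳ e) (h2 : ∀ e x, x ∈ ℳ e → π e x = x)
    (h3 : ∀ e e' x, x ∈ ℳ e → e ≠ e' → π e' x = 0)
    (h4 : ∀ x, ∃ s : Finset (ℕ × ℕ), ∑ e ∈ s, π e x = x)
    (N : Submodule (BGS K m n) M) (hN : IsBigradedSubmodule K m n ℳ N) (e : ℕ × ℕ)
    (x : M) (hx : x ∈ N) : π e x ∈ N := by
  have hom : ∀ e e' y, y ∈ ℳ e' → y ∈ N → π e y ∈ N := by
    intro e e' y hy hyN
    by_cases he : e' = e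
    · subst he; rwa [h2 _ _ hy]
    · rw [h3 _ _ _ hy he]; exact N.zero_mem
  have hx' := hx
  rw [hN] at hx'
  revert e
  induction hx' using Submodule.span_induction with
  | mem y hy => obtain ⟨hy, d, hd⟩ := hy; intro e; exact hom e d y hd hy
  | zero => intro e; rw [map_zero]; exact N.zero_mem
  | add y z hy hz iy iz =>
    rw [← hN] at hy hz
    intro e; rw [map_add]; exact N.add_mem (iy hy e) (iz hz e)
  | smul s y hy iy =>
    rw [← hN] at hy
    have iy := iy hy
    intro e
    clear hx
    induction s using MvPolynomial.induction_on' with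
    | monomial u c =>
      have hh : IsWeightedHomogeneous (bwt m n) (monomial u c) (Finsupp.weight (bwt m n) u) :=
        isWeightedHomogeneous_monomial _ _ _ rfl
      obtain ⟨t, ht⟩ := h4 y
      rw [← ht, Finset.smul_sum, map_sum]
      exact N.sum_mem fun e' _ => hom e _ _ (hM.smul_mem _ e' _ _ hh (h1 e' y))
        (N.smul_mem _ (iy e'))
    | add p q hp hq => rw [add_smul, map_add]; exact N.add_mem hp hq

lemma smul_mem_of_components (L : Submodule (BGS K m n) M) (f : BGS K m n) (x : M)
    (h : ∀ d, weightedHomogeneousComponent (bwt m n) d f • x ∈ L) : f • x ∈ L := by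
  have hf := sum_weightedHomogeneousComponent (bwt m n) f
  rw [finsum_eq_sum _ (weightedHomogeneousComponent_finsupp f)] at hf
  rw [← hf, Finset.sum_smul]
  exact L.sum_mem fun d _ => h d

/-- elements of `N` sent into `L` by the annihilator of `L` -/
def transporter {R M : Type} [CommRing R] [AddCommGroup M] [Module R M]
    (N L : Submodule R M) : Submodule R M where
  carrier := {x | x ∈ N ∧ ∀ f ∈ Module.annihilator R L, f • x ∈ L}
  zero_mem' := ⟨N.zero_mem, fun f _ => by rw [smul_zero]; exact L.zero_mem⟩
  add_mem' := fun ha hb => ⟨N.add_mem ha.1 hb.1, fun f hf => by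
    rw [smul_add]; exact L.add_mem (ha.2 f hf) (hb.2 f hf)⟩
  smul_mem' := fun c x hx => ⟨N.smul_mem c hx.1, fun f hf => by
    rw [smul_comm]; exact L.smul_mem c (hx.2 f hf)⟩

lemma transporter_ann {R M : Type} [CommRing R] [AddCommGroup M] [Module R M]
    (N L : Submodule R M) :
    Module.annihilator R L ≤ (Module.annihilator R (transporter N L)).radical := by
  intro f hf
  refine ⟨2, ?_⟩
  rw [Module.mem_annihilator]
  rintro ⟨x, hx⟩
  ext
  change f ^ 2 • x = 0
  rw [pow_two, mul_smul]
  exact congrArg Subtype.val (Module.mem_annihilator.1 hf ⟨f • x, hx.2 f hf⟩)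

lemma transporter_bigraded (hM : IsBigrading K m n M ℳ) (N L : Submodule (BGS K m n) M)
    (hN : IsBigradedSubmodule K m n ℳ N) (hL : IsBigradedSubmodule K m n ℳ L) :
    IsBigradedSubmodule K m n ℳ (transporter N L) := by
  obtain ⟨π, h1, h2, h3, h4⟩ := exists_proj hM
  have hann : ∀ f ∈ Module.annihilator (BGS K m n) L, ∀ d,
      weightedHomogeneousComponent (bwt m n) d f ∈ Module.annihilator (BGS K m n) L := by
    intro f hf d
    have : L ≤ LinearMap.ker (LinearMap.lsmul (BGS K m n) M
        (weightedHomogeneousComponent (bwt m n) d f)) := by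
      conv_lhs => rw [hL]
      rw [Submodule.span_le]
      rintro x ⟨hx, e, he⟩
      change weightedHomogeneousComponent (bwt m n) d f • x = 0
      have h0 : f • x = 0 := congrArg Subtype.val (Module.mem_annihilator.1 hf ⟨x, hx⟩)
      rw [← proj_smul' hM h2 h3 f d e x he, h0, map_zero]
    rw [Module.mem_annihilator]
    rintro ⟨x, hx⟩
    ext
    exact this hx
  have hcomp : ∀ x ∈ transporter N L, ∀ e, π e x ∈ transporter N L := by
    intro x hx e
    refine ⟨proj_mem hM h1 h2 h3 h4 N hN e x hx.1, fun f hf => ?_⟩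
    refine smul_mem_of_components L f _ fun d => ?_
    rw [← proj_smul hM h1 h2 h3 h4 _ d e
      (weightedHomogeneousComponent_isWeightedHomogeneous d f) x]
    exact proj_mem hM h1 h2 h3 h4 L hL _ _ (hx.2 _ (hann f hf d))
  refine le_antisymm ?_ (Submodule.span_le.2 fun x hx => hx.1)
  intro x hx
  obtain ⟨t, ht⟩ := h4 x
  rw [← ht]
  exact Submodule.sum_mem _ fun e _ => Submodule.subset_span ⟨hcomp x hx e, e, h1 e x⟩

lemma cohDim_Q (L N : Submodule (BGS K m n) M) [Module.Finite (BGS K m n) M]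
    (h : Module.annihilator (BGS K m n) L ≤ (Module.annihilator (BGS K m n) N).radical) :
    cohDim (BGS K m n) (idealQ K m n) N ≤ cohDim (BGS K m n) (idealQ K m n) L := by
  classical
  let s : Finset (Fin m ⊕ Fin n) := Finset.univ.image Sum.inr
  have hs : idealQ K m n = Ideal.span (X '' (s : Set (Fin m ⊕ Fin n))) := by
    unfold idealQ
    congr 1
    ext x
    simp [s]
  refine cohDim_lemma _ L N (s.card + 1) (fun k hk Y => ?_) h
  rw [hs]
  exact dies_big s hk Y

lemma mem_ass_iff_s1 {R M : Type} [CommRing R] [IsNoetherianRing R] [AddCommGroup M] [Module R M]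
    (p : Ideal R) : p ∈ associatedPrimes R M ↔
      p.IsPrime ∧ ∃ x : M, ∀ f, f ∈ p ↔ f • x = 0 := by
  rw [AssociatedPrimes.mem_iff, isAssociatedPrime_iff]
  refine and_congr_right fun _ => exists_congr fun x => ?_
  rw [SetLike.ext_iff]
  simp [Submodule.mem_colon_singleton]

lemma ass_step {R M : Type} [CommRing R] [AddCommGroup M] [Module R M] (N L : Submodule R M)
    (h : L ≤ N) : associatedPrimes R N ⊆ associatedPrimes R L ∪
      associatedPrimes R (N ⧸ Submodule.comap N.subtype L) := by
  refine associatedPrimes.subset_union_of_exact (f := Submodule.inclusion h)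
    (g := Submodule.mkQ _) (Submodule.inclusion_injective h) ?_
  intro x
  simp only [Submodule.mkQ_apply, Submodule.Quotient.mk_eq_zero, Submodule.mem_comap,
    Submodule.subtype_apply]
  constructor
  · intro hx
    exact ⟨⟨x, hx⟩, rfl⟩
  · rintro ⟨y, rfl⟩
    exact y.2

end graded

end helpers

theorem ass_eq_iUnion_ass_quotients
    (K : Type) [Field K] (m n : ℕ)
    (M : Type) [AddCommGroup M] [Module (BGS K m n) M] [Module.Finite (BGS K m n) M]
    (ℳ : ℕ × ℕ → AddSubgroup M) (hM : IsBigrading K m n M ℳ)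
    (r : ℕ) (D : Fin (r + 1) → Submodule (BGS K m n) M)
    (hD : IsDimFiltration K m n ℳ r D) :
    associatedPrimes (BGS K m n) M
      = ⋃ i : Fin r, associatedPrimes (BGS K m n)
          (↥(D i.succ) ⧸ (Submodule.comap (D i.succ).subtype (D i.castSucc))) := by
  apply Set.Subset.antisymm
  · have key : ∀ i : Fin (r + 1), associatedPrimes (BGS K m n) (D i) ⊆
        ⋃ i : Fin r, associatedPrimes (BGS K m n)
          (↥(D i.succ) ⧸ (Submodule.comap (D i.succ).subtype (D i.castSucc))) := by
      intro i
      induction i using Fin.induction with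
      | zero =>
        rw [hD.bot, associatedPrimes.eq_empty_of_subsingleton]
        exact Set.empty_subset _
      | succ i ih =>
        refine (ass_step (D i.succ) (D i.castSucc)
          (hD.strictMono.monotone (Fin.castSucc_le_succ i))).trans ?_
        refine Set.union_subset ih ?_
        exact Set.subset_iUnion (fun i : Fin r => associatedPrimes (BGS K m n)
          (↥(D i.succ) ⧸ (Submodule.comap (D i.succ).subtype (D i.castSucc)))) i
    have h := key (Fin.last r)
    rw [hD.top, LinearEquiv.AssociatedPrimes.eq (Submodule.topEquiv)] at h
    exact h
  · refine Set.iUnion_subset fun i p hp => ?_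
    rw [mem_ass_iff_s1] at hp ⊢
    obtain ⟨hpr, x, hx⟩ := hp
    obtain ⟨⟨x, hxN⟩, rfl⟩ := Submodule.mkQ_surjective _ x
    have hx' : ∀ f, f ∈ p ↔ f • x ∈ D i.castSucc := by
      intro f
      rw [hx, ← map_smul, Submodule.mkQ_apply, Submodule.Quotient.mk_eq_zero]
      rfl
    by_cases ha : Module.annihilator (BGS K m n) (D i.castSucc) ≤ p
    · exfalso
      have hle := hD.largest i (transporter (D i.succ) (D i.castSucc))
        (transporter_bigraded hM _ _ (hD.bigraded _) (hD.bigraded _)) (fun y hy => hy.1)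
        ((cohDim_Q _ _ (transporter_ann _ _)).trans_lt (hD.cd_lt i))
      have hxL : x ∈ D i.castSucc := hle ⟨hxN, fun f hf => (hx' f).1 (ha hf)⟩
      exact hpr.ne_top ((Ideal.eq_top_iff_one p).2 ((hx' 1).2 (by rwa [one_smul])))
    · obtain ⟨s, hs, hsp⟩ := SetLike.not_le_iff_exists.1 ha
      refine ⟨hpr, s • x, fun f => ⟨fun hf => ?_, fun hf => ?_⟩⟩
      · rw [smul_comm]
        exact congrArg Subtype.val (Module.mem_annihilator.1 hs ⟨f • x, (hx' f).1 hf⟩)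
      · have : f * s ∈ p := (hx' _).2 (by rw [mul_smul, hf]; exact Submodule.zero_mem _)
        exact (hpr.mem_or_mem this).resolve_right hsp
end
end

section
/- Let 0 = M_0 ⊊ M_1 ⊊ … ⊊ M_d = M be the dimension filtration of M with respect to Q. Then mgrade(Q, M_i) = cd(Q, M_1) for all i = 1, …, d; in particular all the modules M_1, …, M_d = M have the same mgrade with respect to Q. -/
open CategoryTheory MvPolynomial

noncomputable section

namespace MG
variable {R : Type} [CommRing R]
open HomologicalComplex

lemma iso_swap {C : Type*} [Category C] {A A' B B' : C} (f : A' ⟶ A) (e : A ≅ B) (e' : A' ≅ B')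
    (g : B' ⟶ B) (h : f ≫ e.hom = e'.hom ≫ g) : e'.inv ≫ f = g ≫ e.inv := by
  rw [Iso.inv_comp_eq, ← Category.assoc, ← h]; simp

lemma sq_paste {C : Type*} [Category C] {A A' B B' L L' : C}
    (i' : A' ⟶ B') (e' : B' ⟶ L') (l : L' ⟶ L) (H : B' ⟶ B) (e : B ⟶ L) (i : A ⟶ B) (m : A' ⟶ A)
    (h1 : e' ≫ l = H ≫ e) (h2 : i' ≫ H = m ≫ i) : (i' ≫ e') ≫ l = m ≫ i ≫ e := by
  rw [Category.assoc, h1, ← Category.assoc, h2, Category.assoc]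

/-- The map induced on Hom-complexes. -/
def yonMap {A B : ChainComplex (ModuleCat.{0} R) ℕ} (φ : A ⟶ B) (Y : ModuleCat.{0} R) :
    B.linearYonedaObj R Y ⟶ A.linearYonedaObj R Y :=
  (unopFunctor _ _).map
        ((((linearYoneda R (ModuleCat.{0} R)).obj Y).rightOp.mapHomologicalComplex _).map φ).op

lemma isoExt_nat {X X' : ModuleCat.{0} R} (P : ProjectiveResolution X) (P' : ProjectiveResolution X')
    (g : X' ⟶ X) (φ : P'.complex ⟶ P.complex) (comm : φ.f 0 ≫ P.π.f 0 = P'.π.f 0 ≫ g)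
    (n : ℕ) (Y : ModuleCat.{0} R) :
    ((Ext R (ModuleCat.{0} R) n).map g.op).app Y ≫ (P'.isoExt (R := R) n Y).hom =
      (P.isoExt (R := R) n Y).hom ≫ homologyMap (yonMap φ Y) n := by
  have h1 := P'.isoLeftDerivedObj_inv_naturality g P φ comm
    ((linearYoneda R (ModuleCat.{0} R)).obj Y).rightOp n
  have h2 := homologyOp_hom_naturality ((unopFunctor _ _).map
        ((((linearYoneda R (ModuleCat.{0} R)).obj Y).rightOp.mapHomologicalComplex _).map φ).op) n
  replace h2 := iso_swap _ _ _ _ h2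
  exact congrArg Quiver.Hom.unop (sq_paste _ _ _ _ _ _ _ h1 h2)


lemma homologyπ_surj (K : CochainComplex (ModuleCat.{0} R) ℕ) (n : ℕ) (h : K.homology n) :
    ∃ z : K.cycles n, (K.homologyπ n) z = h :=
  (ModuleCat.epi_iff_surjective (K.homologyπ n)).1 inferInstance h

lemma homologyπ_zero_iff (K : CochainComplex (ModuleCat.{0} R) ℕ) (p n : ℕ) (hp : p + 1 = n)
    (z : K.cycles n) :
    (K.homologyπ n) z = 0 ↔ ∃ y : K.X p, (K.d p n) y = (K.iCycles n) z := by
  have hpn : (ComplexShape.up ℕ).prev n = p := (ComplexShape.up ℕ).prev_eq' hp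
  have ex : (ShortComplex.mk _ _ (K.toCycles_comp_homologyπ p n)).Exact :=
    ShortComplex.exact_of_g_is_cokernel _ (K.homologyIsCokernel p n hpn)
  rw [ShortComplex.moduleCat_exact_iff] at ex
  constructor
  · intro hz
    obtain ⟨y, hy⟩ := ex z hz
    refine ⟨y, ?_⟩
    rw [← K.toCycles_i p n, ModuleCat.comp_apply]
    exact congrArg _ hy
  · rintro ⟨y, hy⟩
    rw [← K.toCycles_i p n, ModuleCat.comp_apply] at hy
    have := (ModuleCat.mono_iff_injective (K.iCycles n)).1 inferInstance hy
    rw [← this, ← ModuleCat.comp_apply, K.toCycles_comp_homologyπ]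
    rfl

lemma exists_cycle (K : CochainComplex (ModuleCat.{0} R) ℕ) (n : ℕ) (x : K.X n)
    (hx : (K.d n (n + 1)) x = 0) : ∃ z : K.cycles n, (K.iCycles n) z = x := by
  have ex : (ShortComplex.mk _ _ (K.iCycles_d n (n+1))).Exact :=
    ShortComplex.exact_of_f_is_kernel _ (K.cyclesIsKernel n (n+1) (by simp))
  rw [ShortComplex.moduleCat_exact_iff] at ex
  exact ex x hx

lemma homologyMap_π {K L : CochainComplex (ModuleCat.{0} R) ℕ} (φ : K ⟶ L) (n : ℕ)
    (z : K.cycles n) : (homologyMap φ n) ((K.homologyπ n) z) = (L.homologyπ n) ((cyclesMap φ n) z) := by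
  rw [← ModuleCat.comp_apply, homologyπ_naturality, ModuleCat.comp_apply]

lemma cyclesMap_i' {K L : CochainComplex (ModuleCat.{0} R) ℕ} (φ : K ⟶ L) (n : ℕ)
    (z : K.cycles n) : (L.iCycles n) ((cyclesMap φ n) z) = (φ.f n) ((K.iCycles n) z) := by
  rw [← ModuleCat.comp_apply, cyclesMap_i, ModuleCat.comp_apply]

/-- `e` is the class of the cocycle `f`. -/
def Rel {X : ModuleCat.{0} R} (P : ProjectiveResolution X) (n : ℕ) (Y : ModuleCat.{0} R)
    (e : ((Ext R (ModuleCat.{0} R) n).obj (Opposite.op X)).obj Y) (f : P.complex.X n ⟶ Y) : Prop :=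
  ∃ z : (P.complex.linearYonedaObj R Y).cycles n,
    ((P.complex.linearYonedaObj R Y).homologyπ n) z = (P.isoExt (R := R) n Y).hom e ∧
    ((P.complex.linearYonedaObj R Y).iCycles n) z = f

section
variable {X X' : ModuleCat.{0} R} (P : ProjectiveResolution X) (P' : ProjectiveResolution X')
  (n : ℕ) (Y : ModuleCat.{0} R)

lemma Rel.cocycle {e} {f} (h : Rel P n Y e f) : P.complex.d (n+1) n ≫ f = 0 := by
  obtain ⟨z, -, rfl⟩ := h
  have := ConcreteCategory.congr_hom ((P.complex.linearYonedaObj R Y).iCycles_d n (n+1)) z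
  exact this

lemma Rel.exists_cocycle (e) : ∃ f, Rel P n Y e f := by
  obtain ⟨z, hz⟩ := homologyπ_surj _ n ((P.isoExt (R := R) n Y).hom e)
  exact ⟨_, z, hz, rfl⟩

lemma Rel.exists_class (f) (hf : P.complex.d (n+1) n ≫ f = 0) : ∃ e, Rel P n Y e f := by
  obtain ⟨z, hz⟩ := exists_cycle (P.complex.linearYonedaObj R Y) n f hf
  refine ⟨(P.isoExt (R := R) n Y).inv (((P.complex.linearYonedaObj R Y).homologyπ n) z), z, ?_, hz⟩
  simp

lemma Rel.zero_iff {e} {f} (h : Rel P n Y e f) (p : ℕ) (hp : p + 1 = n) :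
    e = 0 ↔ ∃ g : P.complex.X p ⟶ Y, P.complex.d n p ≫ g = f := by
  obtain ⟨z, hz, rfl⟩ := h
  have h1 := homologyπ_zero_iff (P.complex.linearYonedaObj R Y) p n hp z
  rw [hz] at h1
  have h2 : (P.isoExt (R := R) n Y).hom e = 0 ↔ e = 0 := by
    constructor
    · intro h
      have := congrArg (P.isoExt (R := R) n Y).inv h
      simpa using this
    · rintro rfl; exact map_zero _
  rw [← h2, h1]
  rfl

lemma Rel.map {e} {f} (h : Rel P n Y e f) (g : X' ⟶ X) (φ : ProjectiveResolution.Hom P' P g) :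
    Rel P' n Y ((((Ext R (ModuleCat.{0} R) n).map g.op).app Y) e) (φ.hom.f n ≫ f) := by
  obtain ⟨z, hz, rfl⟩ := h
  refine ⟨(cyclesMap (yonMap φ.hom Y) n) z, ?_, ?_⟩
  · have := ConcreteCategory.congr_hom (isoExt_nat P P' g φ.hom φ.hom_f_zero_comp_π_f_zero n Y) e
    rw [ModuleCat.comp_apply, ModuleCat.comp_apply, ← hz] at this
    rw [this]
    exact (homologyMap_π _ _ _).symm
  · exact cyclesMap_i' _ _ _
end


open localCohomology Abelian

/-- transition map `R/J^l → R/J^k` -/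
def tr (J : Ideal R) {k l : ℕ} (h : k ≤ l) :
    ModuleCat.of R (R ⧸ J ^ l) ⟶ ModuleCat.of R (R ⧸ J ^ k) :=
  (ringModIdeals (idealPowersDiagram J)).map (homOfLE h).op

lemma tr_comp (J : Ideal R) {k l m : ℕ} (h : k ≤ l) (h' : l ≤ m) :
    tr J h' ≫ tr J h = tr J (h.trans h') := by
  unfold tr
  exact ((ringModIdeals (idealPowersDiagram J)).map_comp _ _).symm

lemma subsing_iff (J : Ideal R) (i : ℕ) (M : ModuleCat.{0} R) :
    Subsingleton ((localCohomology J i).obj M) ↔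
    ∀ (k : ℕ) (e : ((Ext R (ModuleCat.{0} R) i).obj (Opposite.op (ModuleCat.of R (R ⧸ J ^ k)))).obj M),
      ∃ (l : ℕ) (h : k ≤ l), (((Ext R (ModuleCat.{0} R) i).map (tr J h).op).app M) e = 0 := by
  have := hasColimitDiagram.{0, 0} (idealPowersDiagram J) i
  let hc := Limits.isColimitOfPreserves ((evaluation _ _).obj M)
    (Limits.colimit.isColimit (diagram (idealPowersDiagram J) i))
  have key : ∀ (k : ℕ) (e : ((Ext R (ModuleCat.{0} R) i).obj (Opposite.op (ModuleCat.of R (R ⧸ J ^ k)))).obj M),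
    ((Limits.colimit.ι (diagram (idealPowersDiagram J) i) (Opposite.op (Opposite.op k))).app M) e = 0 ↔
      ∃ (l : ℕ) (h : k ≤ l), (((Ext R (ModuleCat.{0} R) i).map (tr J h).op).app M) e = 0 := by
    intro k e
    constructor
    · intro h0
      obtain ⟨l, f, hf⟩ := Limits.Concrete.isColimit_exists_of_rep_eq _ hc
        (i := Opposite.op (Opposite.op k)) (j := Opposite.op (Opposite.op k)) e 0 (h0.trans (map_zero _).symm)
      obtain ⟨g, hg⟩ := hf
      refine ⟨l.unop.unop, f.unop.unop.le, ?_⟩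
      exact hg.trans (map_zero _)
    · rintro ⟨l, h, hl⟩
      have := Limits.colimit.w (diagram (idealPowersDiagram J) i) (homOfLE h).op.op
      have h2 := ConcreteCategory.congr_hom (congrArg (fun t => t.app M) this) e
      refine h2.symm.trans ?_
      exact (congrArg (ConcreteCategory.hom ((Limits.colimit.ι (diagram (idealPowersDiagram J) i)
        (Opposite.op (Opposite.op l))).app M)) hl).trans (map_zero _)
  constructor
  · intro hs k e
    rw [← key]
    exact hs.elim _ _
  · intro h
    refine subsingleton_of_forall_eq 0 fun x => ?_
    obtain ⟨j, y, hy⟩ := Limits.Concrete.isColimit_exists_rep _ hc x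
    rw [← hy]
    exact (key j.unop.unop y).2 (h _ _)

/-- new-style vanishing -/
def Van (J : Ideal R) (i : ℕ) (M : ModuleCat.{0} R) : Prop :=
  ∀ (k : ℕ) (e : Abelian.Ext.{0} (ModuleCat.of R (R ⧸ J ^ k)) M i), ∃ (l : ℕ) (h : k ≤ l),
    (Abelian.Ext.mk₀ (tr J h)).comp e (zero_add i) = 0

lemma subsing_iff_van (J : Ideal R) (i : ℕ) (M : ModuleCat.{0} R) :
    Subsingleton ((localCohomology J (i+1)).obj M) ↔ Van J (i+1) M := by
  rw [subsing_iff]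
  let P (k : ℕ) : ProjectiveResolution (ModuleCat.of R (R ⧸ J ^ k)) := projectiveResolution _
  let φ {k l : ℕ} (h : k ≤ l) : ProjectiveResolution.Hom (P l) (P k) (tr J h) :=
    ⟨ProjectiveResolution.lift (tr J h) (P l) (P k),
      by have := HomologicalComplex.congr_hom (ProjectiveResolution.lift_commutes (tr J h) (P l) (P k)) 0
         exact this⟩
  refine forall_congr' fun k => ?_
  constructor
  · intro H e
    obtain ⟨f, hf, rfl⟩ := (P k).extMk_surjective e _ rfl
    obtain ⟨e', he'⟩ := Rel.exists_class (P k) (i+1) M f hf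
    obtain ⟨l, h, hl⟩ := H e'
    refine ⟨l, h, ?_⟩
    rw [ProjectiveResolution.mk₀_comp_extMk (φ := φ h), ProjectiveResolution.extMk_eq_zero_iff (p := i) (hp := rfl)]
    rwa [(he'.map _ _ _ _ _ (φ h)).zero_iff _ _ _ i rfl] at hl
  · intro H e
    obtain ⟨f, hf⟩ := Rel.exists_cocycle (P k) (i+1) M e
    obtain ⟨l, h, hl⟩ := H ((P k).extMk f _ rfl hf.cocycle)
    refine ⟨l, h, ?_⟩
    rw [ProjectiveResolution.mk₀_comp_extMk (φ := φ h), ProjectiveResolution.extMk_eq_zero_iff (p := i) (hp := rfl)] at hl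
    rwa [(hf.map _ _ _ _ _ (φ h)).zero_iff _ _ _ i rfl]

lemma van_X₂ (J : Ideal R) (i : ℕ) {S : ShortComplex (ModuleCat.{0} R)} (hS : S.ShortExact)
    (h1 : Van J i S.X₁) (h3 : Van J i S.X₃) : Van J i S.X₂ := by
  intro k e
  obtain ⟨l, hl, H⟩ := h3 k (e.comp (Abelian.Ext.mk₀ S.g) (add_zero i))
  rw [← Abelian.Ext.comp_assoc _ _ _ (zero_add i) _ (by simp)] at H
  obtain ⟨x, hx⟩ := Abelian.Ext.covariant_sequence_exact₂ _ hS _ H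
  obtain ⟨m, hm, H'⟩ := h1 l x
  refine ⟨m, hl.trans hm, ?_⟩
  rw [← tr_comp J hl hm, ← Abelian.Ext.mk₀_comp_mk₀, Abelian.Ext.comp_assoc _ _ _ _ (zero_add i) (by simp), ← hx,
    ← Abelian.Ext.comp_assoc _ _ _ (zero_add i) _ (by simp), H']
  simp

lemma van_X₃ (J : Ideal R) (i : ℕ) {S : ShortComplex (ModuleCat.{0} R)} (hS : S.ShortExact)
    (h1 : Van J (i+1) S.X₁) (h2 : Van J i S.X₂) : Van J i S.X₃ := by
  intro k e
  obtain ⟨l, hl, H⟩ := h1 k (e.comp hS.extClass rfl)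
  rw [← Abelian.Ext.comp_assoc _ _ _ (zero_add i) _ (by simp)] at H
  obtain ⟨x, hx⟩ := Abelian.Ext.covariant_sequence_exact₃ _ hS _ _ H
  obtain ⟨m, hm, H'⟩ := h2 l x
  refine ⟨m, hl.trans hm, ?_⟩
  rw [← tr_comp J hl hm, ← Abelian.Ext.mk₀_comp_mk₀, Abelian.Ext.comp_assoc _ _ _ _ (zero_add i) (by simp), ← hx,
    ← Abelian.Ext.comp_assoc _ _ _ (zero_add i) _ (by simp), H']
  simp

lemma van_iso (J : Ideal R) (i : ℕ) {A B : ModuleCat.{0} R} (e : A ≅ B) (h : Van J i A) :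
    Van J i B := by
  intro k x
  obtain ⟨l, hl, H⟩ := h k (x.comp (Abelian.Ext.mk₀ e.inv) (add_zero i))
  refine ⟨l, hl, ?_⟩
  have := congrArg (fun t => Abelian.Ext.comp t (Abelian.Ext.mk₀ e.hom) (add_zero i)) H
  simpa using this

end MG


namespace MG
section Syz

/-- short exact sequences from linear maps -/
lemma mkSE {R : Type} [CommRing R] {A B C : Type} [AddCommGroup A] [AddCommGroup B] [AddCommGroup C]
    [Module R A] [Module R B] [Module R C] (f : A →ₗ[R] B) (g : B →ₗ[R] C)
    (hf : Function.Injective f) (hg : Function.Surjective g) (h : Function.Exact f g) :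
    (ShortComplex.mk (ModuleCat.ofHom f) (ModuleCat.ofHom g)
      (by ext x; exact h.apply_apply_eq_zero x)).ShortExact where
  exact := (ShortComplex.ShortExact.moduleCat_exact_iff_function_exact _).2 h
  mono_f := (ModuleCat.mono_iff_injective _).2 hf
  epi_g := (ModuleCat.epi_iff_surjective _).2 hg

variable {R : Type} [CommRing R] 

open Polynomial TensorProduct

lemma pd_baseChange (N : ℕ) (M : ModuleCat.{0} R) (h : HasProjectiveDimensionLT M (N+1)) :
    HasProjectiveDimensionLT (ModuleCat.of R[X] (R[X] ⊗[R] M)) (N+1) := by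
  induction N generalizing M with
  | zero =>
    rw [zero_add, ← projective_iff_hasProjectiveDimensionLT_one, ← IsProjective.iff_projective] at h ⊢
    infer_instance
  | succ N ih =>
    have hS := M.shortExact_projectiveShortComplex
    have hp : Projective M.projectiveShortComplex.X₂ := by
      rw [← IsProjective.iff_projective]; infer_instance
    have h1 := (hS.hasProjectiveDimensionLT_X₃_iff N hp).1 h
    have hT := mkSE (R := R[X]) (M.projectiveShortComplex.f.hom.baseChange R[X])
      (M.projectiveShortComplex.g.hom.baseChange R[X])
      (Module.Flat.lTensor_preserves_injective_linearMap _ ((ModuleCat.mono_iff_injective _).1 hS.mono_f))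
      (LinearMap.lTensor_surjective _ ((ModuleCat.epi_iff_surjective _).1 hS.epi_g))
      (lTensor_exact _ ((ShortComplex.ShortExact.moduleCat_exact_iff_function_exact _).1 hS.exact)
        ((ModuleCat.epi_iff_surjective _).1 hS.epi_g))
    refine (hT.hasProjectiveDimensionLT_X₃_iff N ?_).2 (ih _ h1)
    rw [← IsProjective.iff_projective]
    infer_instance

variable {M : Type} [AddCommGroup M] [Module R M] [Module R[X] M] [IsScalarTower R R[X] M]

open PolynomialModule in
def eps : PolynomialModule R M →ₗ[R[X]] M where
  toFun p := p.coeff.sum fun i m => (X : R[X]) ^ i • m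
  map_add' _ _ := Finsupp.sum_add_index' (fun _ => smul_zero _) fun _ _ _ => smul_add _ _ _
  map_smul' f p := by
    dsimp
    have hadd : ∀ p q : PolynomialModule R M, (p + q).coeff.sum (fun i m => (X : R[X]) ^ i • m) =
      p.coeff.sum (fun i m => (X : R[X]) ^ i • m) + q.coeff.sum (fun i m => (X : R[X]) ^ i • m) :=
      fun _ _ => Finsupp.sum_add_index' (fun _ => smul_zero _) fun _ _ _ => smul_add _ _ _
    induction p using PolynomialModule.induction_linear with
    | zero => simp
    | add a b ha hb => rw [smul_add, hadd, ha, hb, hadd, smul_add]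
    | single i m =>
      induction f using Polynomial.induction_on' with
      | add p q hp hq => rw [add_smul, hadd, hp, hq, add_smul]
      | monomial j r =>
        rw [monomial_smul_single, coeff_single, coeff_single, Finsupp.sum_single_index (by simp),
          Finsupp.sum_single_index (by simp), ← Polynomial.C_mul_X_pow_eq_monomial, smul_smul, mul_assoc, ← pow_add,
          mul_smul, ← algebraMap_smul R[X] r m, smul_comm]
        rfl

lemma eps_single (i : ℕ) (m : M) : eps (PolynomialModule.single R i m) = (X : R[X]) ^ i • m :=
  Finsupp.sum_single_index (by simp)

/-- multiplication by `X` as an `R`-linear map -/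
def mulX : M →ₗ[R] M := (LinearMap.lsmul R[X] M (X : R[X])).restrictScalars R

lemma mulX_apply (m : M) : (mulX (R := R) m) = (X : R[X]) • m := rfl

def del : PolynomialModule R M →ₗ[R[X]] PolynomialModule R M where
  toFun p := (X : R[X]) • p - PolynomialModule.map R (mulX (R := R)) p
  map_add' _ _ := by simp; abel
  map_smul' f p := by
    have := PolynomialModule.map_smul R (mulX (R := R)) f p
    simp only [Algebra.algebraMap_self, Polynomial.map_id] at this
    rw [this, smul_comm, RingHom.id_apply, smul_sub]

lemma X_smul_single (i : ℕ) (m : M) : (X : R[X]) • PolynomialModule.single R i m = PolynomialModule.single R (i+1) m := by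
  rw [← monomial_one_one_eq_X, PolynomialModule.monomial_smul_single, one_smul, add_comm]

lemma del_single (i : ℕ) (m : M) : del (PolynomialModule.single R i m) = 
    PolynomialModule.single R (i+1) m - PolynomialModule.single R i ((X : R[X]) • m) := by
  show (X : R[X]) • _ - PolynomialModule.map R (mulX (R := R)) _ = _
  rw [X_smul_single, PolynomialModule.map_single, mulX_apply]

lemma eps_del (p : PolynomialModule R M) : eps (del p) = 0 := by
  induction p using PolynomialModule.induction_linear with
  | zero => simp
  | add a b ha hb => simp [ha, hb]
  | single i m => rw [del_single, map_sub, eps_single, eps_single, pow_succ, mul_smul, sub_self]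

lemma exists_del (p : PolynomialModule R M) : ∃ q, p = del q + PolynomialModule.single R 0 (eps p) := by
  induction p using PolynomialModule.induction_linear with
  | zero => exact ⟨0, by simp⟩
  | add a b ha hb =>
    obtain ⟨q, hq⟩ := ha
    obtain ⟨q', hq'⟩ := hb
    refine ⟨q + q', ?_⟩
    rw [map_add, map_add, PolynomialModule.single_add]
    nth_rewrite 1 [hq, hq']
    abel
  | single i m =>
    induction i generalizing m with
    | zero => exact ⟨0, by simp [eps_single]⟩
    | succ i ih =>
      obtain ⟨q, hq⟩ := ih ((X : R[X]) • m)
      refine ⟨q + PolynomialModule.single R i m, ?_⟩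
      rw [map_add, del_single]
      rw [eps_single] at hq ⊢
      rw [hq, pow_succ, mul_smul]
      abel

lemma del_inj : Function.Injective (del : PolynomialModule R M →ₗ[R[X]] PolynomialModule R M) := by
  rw [injective_iff_map_eq_zero]
  intro p hp
  have h1 : ∀ n, p.coeff n = (X : R[X]) • p.coeff (n+1) := by
    intro n
    have h2 : (X : R[X]) • p = PolynomialModule.map R (mulX (R := R)) p := sub_eq_zero.1 hp
    have h3 := congrArg (fun t => PolynomialModule.coeff t (n+1)) h2
    rw [← monomial_one_one_eq_X] at h3
    simp only [PolynomialModule.monomial_smul_apply] at h3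
    rw [if_pos (by omega), one_smul, Nat.add_sub_cancel] at h3
    rw [h3]
    simp [PolynomialModule.map, mulX_apply]
  have h2 : ∀ k n, p.coeff n = (X : R[X])^k • p.coeff (n+k) := by
    intro k
    induction k with
    | zero => simp
    | succ k ih => intro n; rw [ih, h1 (n+k), smul_smul, ← pow_succ]; rfl
  ext n
  obtain ⟨B, hB⟩ := p.coeff.support.bddAbove
  have : p.coeff (n + (B+1)) = 0 := by
    by_contra hne
    have := hB (Finsupp.mem_support_iff.2 hne)
    omega
  rw [h2 (B+1), this]; simp

lemma pd_poly {N : ℕ} (h : ∀ M : ModuleCat.{0} R, HasProjectiveDimensionLT M (N+1)) (M : ModuleCat.{0} R[X]) :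
    HasProjectiveDimensionLT M (N+2) := by
  let _ : Module R M := Module.compHom M (C : R →+* R[X])
  have : IsScalarTower R R[X] M := ⟨fun r f m => by
    rw [Polynomial.smul_eq_C_mul, mul_smul]; rfl⟩
  have hse := mkSE (R := R[X]) (A := PolynomialModule R M) (B := PolynomialModule R M) (C := M) del eps del_inj
    (fun m => ⟨PolynomialModule.single R 0 m, by rw [eps_single]; simp⟩)
    (fun p => ⟨fun hp => by
      obtain ⟨q, hq⟩ := exists_del p
      rw [hp] at hq
      exact ⟨q, by rw [hq]; simp⟩, by rintro ⟨q, rfl⟩; exact eps_del q⟩)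
  have hP : HasProjectiveDimensionLT (ModuleCat.of R[X] (PolynomialModule R M)) (N+1) := by
    have := pd_baseChange N (ModuleCat.of R M) (h _)
    exact hasProjectiveDimensionLT_of_iso
      (PolynomialModule.polynomialTensorProductLEquivPolynomialModule R M).toModuleIso (N+1)
  exact hse.hasProjectiveDimensionLT_X₃ (N+1) hP (hasProjectiveDimensionLT_of_ge _ (N+1) _ (Nat.le_succ _))

attribute [local instance] RingHomInvPair.of_ringEquiv in
lemma pd_equiv {R' : Type} [CommRing R'] (e : R ≃+* R') {N : ℕ}
    (h : ∀ M : ModuleCat.{0} R, HasProjectiveDimensionLT M (N+1)) (M : ModuleCat.{0} R') :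
    HasProjectiveDimensionLT M (N+1) := by
  let _ : Module R M := Module.compHom M (e : R →+* R')
  have := h (ModuleCat.of R M)
  let f : (ModuleCat.of R M) ≃ₛₗ[RingHomClass.toRingHom e] M :=
    { AddEquiv.refl M with
      map_smul' := fun r m => rfl }
  exact ModuleCat.hasProjectiveDimensionLE_of_semiLinearEquiv e f N

lemma pd_field (K : Type) [Field K] (M : ModuleCat.{0} K) : HasProjectiveDimensionLT M 1 := by
  rw [← projective_iff_hasProjectiveDimensionLT_one, ← IsProjective.iff_projective]
  exact Module.Projective.of_free

lemma pd_fin (K : Type) [Field K] (k : ℕ) (M : ModuleCat.{0} (MvPolynomial (Fin k) K)) :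
    HasProjectiveDimensionLT M (k+1) := by
  induction k with
  | zero => exact pd_equiv (MvPolynomial.isEmptyAlgEquiv K (Fin 0)).symm.toRingEquiv (pd_field K) M
  | succ k ih =>
    exact pd_equiv (MvPolynomial.finSuccEquiv K k).symm.toRingEquiv (pd_poly ih) M

lemma pd_mv (K : Type) [Field K] (m n : ℕ) (M : ModuleCat.{0} (MvPolynomial (Fin m ⊕ Fin n) K)) :
    HasProjectiveDimensionLT M (m+n+1) :=
  pd_equiv (MvPolynomial.renameEquiv K finSumFinEquiv.symm).toRingEquiv (pd_fin K (m+n)) M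

end Syz
end MG


namespace MG
section Desc
variable {R : Type} [CommRing R]

lemma van_subsingleton (J : Ideal R) (i : ℕ) (N : Type) [AddCommGroup N] [Module R N] [Subsingleton N] :
    Van J i (ModuleCat.of R N) := by
  intro k e
  refine ⟨k, le_rfl, ?_⟩
  have hz : Limits.IsZero (ModuleCat.of R N) := ModuleCat.isZero_of_subsingleton _
  have : e = 0 := by
    rw [← e.comp_mk₀_id, hz.eq_of_src (𝟙 _) 0]
    simp
  rw [this]; simp

lemma van_large (J : Ideal R) {N : ℕ} (h : ∀ M : ModuleCat.{0} R, HasProjectiveDimensionLT M N)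
    (M : ModuleCat.{0} R) {i : ℕ} (hi : N ≤ i) : Van J i M := by
  intro k e
  refine ⟨k, le_rfl, ?_⟩
  have := h (ModuleCat.of R (R ⧸ J ^ k))
  rw [Abelian.Ext.eq_zero_of_hasProjectiveDimensionLT e N hi]; simp

lemma van_equiv (J : Ideal R) (i : ℕ) {A B : Type} [AddCommGroup A] [AddCommGroup B] [Module R A] [Module R B]
    (e : A ≃ₗ[R] B) (h : Van J i (ModuleCat.of R A)) : Van J i (ModuleCat.of R B) :=
  van_iso J i e.toModuleIso h

lemma van_mid (J : Ideal R) (i : ℕ) {A B C : Type} [AddCommGroup A] [AddCommGroup B] [AddCommGroup C]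
    [Module R A] [Module R B] [Module R C] (f : A →ₗ[R] B) (g : B →ₗ[R] C)
    (hf : Function.Injective f) (hg : Function.Surjective g) (h : Function.Exact f g)
    (h1 : Van J i (ModuleCat.of R A)) (h3 : Van J i (ModuleCat.of R C)) : Van J i (ModuleCat.of R B) :=
  van_X₂ J i (mkSE f g hf hg h) h1 h3

lemma van_right (J : Ideal R) (i : ℕ) {A B C : Type} [AddCommGroup A] [AddCommGroup B] [AddCommGroup C]
    [Module R A] [Module R B] [Module R C] (f : A →ₗ[R] B) (g : B →ₗ[R] C)
    (hf : Function.Injective f) (hg : Function.Surjective g) (h : Function.Exact f g)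
    (h1 : Van J (i+1) (ModuleCat.of R A)) (h2 : Van J i (ModuleCat.of R B)) : Van J i (ModuleCat.of R C) :=
  van_X₃ J i (mkSE f g hf hg h) h1 h2

lemma van_ann [IsNoetherianRing R] (J : Ideal R) (t : ℕ) (I : Ideal R)
    (h : ∀ q : Ideal R, q.IsPrime → I ≤ q → Van J t (ModuleCat.of R (R ⧸ q)))
    (N : Type) [AddCommGroup N] [Module R N] [hf : Module.Finite R N]
    (hN : I ≤ Module.annihilator R N) : Van J t (ModuleCat.of R N) := by
  revert hN
  induction hf using IsNoetherianRing.induction_on_isQuotientEquivQuotientPrime (A := R) with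
  | subsingleton N => intro _; exact van_subsingleton J t N
  | quotient N p e =>
    intro hN
    refine van_equiv J t e.symm (h _ p.2 ?_)
    rw [e.annihilator_eq, Ideal.annihilator_quotient] at hN
    exact hN
  | exact A B C f g hf hg hfg hA hC =>
    intro hN
    exact van_mid J t f g hf hg hfg (hA (hN.trans (f.annihilator_le_of_injective hf)))
      (hC (hN.trans (g.annihilator_le_of_surjective hg)))

lemma van_step [IsNoetherianRing R] (J : Ideal R) (t : ℕ) (D : Type) [AddCommGroup D] [Module R D]
    [Module.Finite R D]
    (h : ∀ q : Ideal R, q.IsPrime → Module.annihilator R D ≤ q → Van J (t+1) (ModuleCat.of R (R ⧸ q)))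
    (hD : Van J t (ModuleCat.of R D)) (q : Ideal R) :
    q.IsPrime → Module.annihilator R D ≤ q → Van J t (ModuleCat.of R (R ⧸ q)) := by
  induction q using WellFoundedGT.induction with
  | ind q ih =>
    intro hq hDq
    have hns : ¬ Subsingleton (D →ₗ[R] (R ⧸ q)) := by
      rw [IsSMulRegular.subsingleton_linearMap_iff]
      rintro ⟨r, hr, hreg⟩
      have h1 : r • (1 : R ⧸ q) = r • 0 := by
        rw [smul_zero, Algebra.smul_def, mul_one]
        exact Ideal.Quotient.eq_zero_iff_mem.2 (hDq hr)
      exact one_ne_zero (hreg h1)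
    rw [not_subsingleton_iff_nontrivial] at hns
    obtain ⟨ψ, hψ⟩ := exists_ne (0 : D →ₗ[R] (R ⧸ q))
    have hI : Van J t (ModuleCat.of R (LinearMap.range ψ)) := by
      refine van_right J t (LinearMap.ker ψ).subtype ψ.rangeRestrict Subtype.val_injective
        ψ.surjective_rangeRestrict ?_ ?_ hD
      · rw [LinearMap.exact_iff]; simp
      · exact van_ann J (t+1) _ h _ ((LinearMap.ker ψ).subtype.annihilator_le_of_injective Subtype.val_injective)
    refine van_mid J t (LinearMap.range ψ).subtype (LinearMap.range ψ).mkQ Subtype.val_injective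
      (Submodule.mkQ_surjective _) (by rw [LinearMap.exact_iff]; simp) hI ?_
    refine van_ann J t (Module.annihilator R ((R ⧸ q) ⧸ LinearMap.range ψ)) ?_ _ le_rfl
    intro q' hq' hle
    obtain ⟨d, hd⟩ : ∃ d, ψ d ≠ 0 := by
      by_contra! hc
      exact hψ (LinearMap.ext hc)
    obtain ⟨a, ha⟩ := Ideal.Quotient.mk_surjective (ψ d)
    have hqle : q ≤ Module.annihilator R ((R ⧸ q) ⧸ LinearMap.range ψ) := by
      refine le_trans (Ideal.annihilator_quotient (I := q)).ge 
        ((LinearMap.range ψ).mkQ.annihilator_le_of_surjective (Submodule.mkQ_surjective _))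
    have haq : a ∉ q := by
      intro haq
      rw [← ha] at hd
      exact hd (Ideal.Quotient.eq_zero_iff_mem.2 haq)
    have ha' : a ∈ Module.annihilator R ((R ⧸ q) ⧸ LinearMap.range ψ) := by
      rw [Module.mem_annihilator]
      intro y
      obtain ⟨z, rfl⟩ := Submodule.mkQ_surjective _ y
      obtain ⟨b, rfl⟩ := Ideal.Quotient.mk_surjective z
      rw [← map_smul, Submodule.mkQ_apply, Submodule.Quotient.mk_eq_zero]
      refine ⟨b • d, ?_⟩
      rw [map_smul, ← ha, Algebra.smul_def, Algebra.smul_def, mul_comm]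
      rfl
    refine ih q' (lt_of_le_of_ne (hqle.trans hle) ?_) hq' (hDq.trans (hqle.trans hle))
    rintro rfl
    exact haq (hle ha')

lemma van_primes [IsNoetherianRing R] (J : Ideal R) {N : ℕ}
    (hpd : ∀ M : ModuleCat.{0} R, HasProjectiveDimensionLT M N) (c : ℕ)
    (D : Type) [AddCommGroup D] [Module R D] [Module.Finite R D]
    (hD : ∀ t, c < t → Van J t (ModuleCat.of R D)) (q : Ideal R) (hq : q.IsPrime)
    (hDq : Module.annihilator R D ≤ q) (t : ℕ) (ht : c < t) : Van J t (ModuleCat.of R (R ⧸ q)) := by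
  have key : ∀ s t, c < t → N ≤ t + s → ∀ q : Ideal R, q.IsPrime → Module.annihilator R D ≤ q →
      Van J t (ModuleCat.of R (R ⧸ q)) := by
    intro s
    induction s with
    | zero => intro t _ hN q _ _; exact van_large J hpd _ (by omega)
    | succ s ih =>
      intro t ht hN q hq hDq
      exact van_step J t D (ih (t+1) (by omega) (by omega)) (hD t ht) q hq hDq
  exact key N t ht (by omega) q hq hDq

end Desc
end MG


namespace MG
section Hom
variable {K : Type} [Field K] {m n : ℕ} {M : Type} [AddCommGroup M] [Module (BGS K m n) M]
  {ℳ : ℕ × ℕ → AddSubgroup M}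

/-- existence of component projections -/
lemma exists_proj (hM : DirectSum.IsInternal ℳ) : ∃ (π : ℕ × ℕ → M →+ M) (supp : M → Finset (ℕ × ℕ)),
    (∀ d x, π d x ∈ ℳ d) ∧ (∀ d e x, x ∈ ℳ e → π d x = if d = e then x else 0) ∧
    (∀ x d, d ∈ supp x ↔ π d x ≠ 0) ∧ ∀ x, x = ∑ d ∈ supp x, π d x := by
  classical
  let _ := hM.chooseDecomposition ℳ
  refine ⟨fun d => (ℳ d).subtype.comp ((DFinsupp.evalAddMonoidHom d).comp
    (DirectSum.decomposeAddEquiv ℳ).toAddMonoidHom),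
    fun x => (DirectSum.decompose ℳ x).support, ?_, ?_, ?_, ?_⟩
  · intro d x; exact (DirectSum.decompose ℳ x d).2
  · intro d e x hx
    show ((DirectSum.decompose ℳ x d : ℳ d) : M) = _
    split_ifs with h
    · subst h; exact DirectSum.decompose_of_mem_same ℳ hx
    · exact DirectSum.decompose_of_mem_ne ℳ hx (Ne.symm h)
  · intro x d
    show _ ↔ ((DirectSum.decompose ℳ x d : ℳ d) : M) ≠ _
    simp
  · intro x
    exact (DirectSum.sum_support_decompose ℳ x).symm

lemma exists_comp (f : BGS K m n) : ∃ T : Finset (ℕ × ℕ),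
    f = ∑ e ∈ T, weightedHomogeneousComponent (bwt m n) e f := by
  have h := weightedHomogeneousComponent_finsupp (w := bwt m n) f
  refine ⟨h.toFinset, ?_⟩
  conv_lhs => rw [← sum_weightedHomogeneousComponent (bwt m n) f]
  exact finsum_eq_sum _ h

lemma hom_ass_aux (hM : IsBigrading K m n M ℳ) (p : Ideal (BGS K m n)) (hp : p.IsPrime)
    (x : M) (hx : ∀ s, s ∈ p ↔ s • x = 0) :
    ∃ d, ∃ y ∈ ℳ d, ∀ s : BGS K m n, s ∈ p ↔ s • y = 0 := by
  classical
  obtain ⟨π, supp, hπ, hπe, hsupp, hsum⟩ := exists_proj hM.internal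
  have hact : ∀ (e k : ℕ × ℕ) (s : BGS K m n) (x : M), IsWeightedHomogeneous (bwt m n) s e →
      π k (s • x) = ∑ d ∈ supp x, if k = e + d then s • π d x else 0 := by
    intro e k s x hs
    conv_lhs => rw [hsum x, Finset.smul_sum, map_sum]
    exact Finset.sum_congr rfl fun d _ => hπe _ _ _ (hM.smul_mem e d s _ hs (hπ d x))
  have hact2 : ∀ (e k : ℕ × ℕ) (s : BGS K m n) (x : M), IsWeightedHomogeneous (bwt m n) s e →
      π (e + k) (s • x) = s • π k x := by
    intro e k s x hs
    rw [hact e _ s x hs]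
    simp only [add_right_inj, Finset.sum_ite_eq]
    split_ifs with h
    · rfl
    · rw [hsupp, not_not] at h; rw [h, smul_zero]
  obtain ⟨N, hN⟩ : ∃ N, (supp x).card = N := ⟨_, rfl⟩
  induction N using Nat.strong_induction_on generalizing x with
  | _ N ih =>
  by_cases hcase : ∀ f ∈ p, ∀ e, weightedHomogeneousComponent (bwt m n) e f ∈ p
  · -- p homogeneous
    have hkill : ∀ s ∈ p, ∀ d, s • π d x = 0 := by
      intro s hs d
      obtain ⟨T, hT⟩ := exists_comp s
      rw [hT, Finset.sum_smul]
      refine Finset.sum_eq_zero fun e _ => ?_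
      rw [← hact2 e d _ x (weightedHomogeneousComponent_isWeightedHomogeneous e s),
        (hx _).1 (hcase s hs e), map_zero]
    have hle : (supp x).inf (fun d => LinearMap.ker (LinearMap.toSpanSingleton (BGS K m n) M (π d x))) ≤ p := by
      intro s hs
      rw [hx, hsum x, Finset.smul_sum]
      refine Finset.sum_eq_zero fun d hd => ?_
      have := Finset.inf_le (f := fun d => LinearMap.ker (LinearMap.toSpanSingleton (BGS K m n) M (π d x))) hd hs
      simpa using this
    obtain ⟨d, hd, hdp⟩ := (Ideal.IsPrime.inf_le' hp).1 hle
    refine ⟨d, π d x, hπ d x, fun s => ⟨fun hs => hkill s hs d, fun hs => hdp ?_⟩⟩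
    simpa using hs
  · push Not at hcase
    obtain ⟨f, hf, e₀, he₀⟩ := hcase
    obtain ⟨T, hT⟩ := exists_comp f
    let c := fun e => weightedHomogeneousComponent (bwt m n) e f
    have hc : ∀ e, IsWeightedHomogeneous (bwt m n) (c e) e := fun e =>
      weightedHomogeneousComponent_isWeightedHomogeneous e f
    obtain ⟨e, he, hemax⟩ : ∃ e ∈ T.filter (fun e => c e ∉ p), ∀ e' ∈ T.filter (fun e => c e ∉ p),
        toLex e' ≤ toLex e := by
      refine Finset.exists_max_image _ toLex ?_
      by_contra hne
      rw [Finset.not_nonempty_iff_eq_empty, Finset.filter_eq_empty_iff] at hne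
      apply he₀
      rw [hT, map_sum]
      refine Ideal.sum_mem _ fun e' he' => ?_
      by_cases h : e' = e₀
      · subst h
        rw [(hc e').weightedHomogeneousComponent_same]
        simpa using hne he'
      · rw [(hc e').weightedHomogeneousComponent_ne _ (Ne.symm h)]
        exact p.zero_mem
    rw [Finset.mem_filter] at he
    have hx0 : (supp x).Nonempty := by
      by_contra hne
      rw [Finset.not_nonempty_iff_eq_empty] at hne
      apply he.2
      rw [hx, hsum x, hne]; simp
    obtain ⟨d, hd, hdmax⟩ := Finset.exists_max_image (supp x) toLex hx0
    have htop : c e • π d x = 0 := by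
      have h0 : π (e + d) (f • x) = 0 := by rw [(hx f).1 hf, map_zero]
      rw [hT, Finset.sum_smul, map_sum, Finset.sum_eq_single e] at h0
      · rw [← hact2 e d _ x (hc e)]; exact h0
      · intro e' he' hne
        by_cases hp' : c e' ∈ p
        · rw [(hx _).1 hp', map_zero]
        · have hlt : toLex e' < toLex e := lt_of_le_of_ne (hemax e' (Finset.mem_filter.2 ⟨he', hp'⟩))
            (fun h => hne (toLex.injective h))
          rw [hact e' _ _ x (hc e')]
          refine Finset.sum_eq_zero fun d' hd' => if_neg ?_
          intro heq
          have h1 : toLex e' + toLex d' < toLex e + toLex d := add_lt_add_of_lt_of_le hlt (hdmax d' hd')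
          have h2 : toLex e + toLex d = toLex e' + toLex d' := congrArg toLex heq
          exact absurd h2 h1.ne'
      · intro h; exact absurd he.1 h
    refine ih (supp (c e • x)).card ?_ (c e • x) ?_ rfl
    · rw [← hN]
      calc (supp (c e • x)).card ≤ (((supp x).erase d).image (fun d' => e + d')).card := by
            refine Finset.card_le_card fun k hk => ?_
            rw [hsupp, hact e k _ x (hc e)] at hk
            obtain ⟨d', hd', hne⟩ := Finset.exists_ne_zero_of_sum_ne_zero hk
            have hk' : k = e + d' := by
              by_contra h; exact hne (if_neg h)
            rw [if_pos hk'] at hne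
            refine Finset.mem_image.2 ⟨d', Finset.mem_erase.2 ⟨?_, hd'⟩, hk'.symm⟩
            rintro rfl
            exact hne htop
        _ ≤ ((supp x).erase d).card := Finset.card_image_le
        _ < (supp x).card := Finset.card_erase_lt_of_mem hd
    · intro s
      rw [smul_smul, ← hx]
      exact ⟨fun h => Ideal.mul_mem_right _ _ h, fun h => (hp.mem_or_mem h).resolve_right he.2⟩

lemma hom_ass (hM : IsBigrading K m n M ℳ) (p : Ideal (BGS K m n))
    (h : p ∈ associatedPrimes (BGS K m n) M) :
    p.IsPrime ∧ ∃ d, ∃ y ∈ ℳ d, p = LinearMap.ker (LinearMap.toSpanSingleton (BGS K m n) M y) := by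
  obtain ⟨hp, x, hx⟩ := Submodule.isAssociatedPrime_iff.1 h
  refine ⟨hp, ?_⟩
  obtain ⟨d, y, hy, hs⟩ := hom_ass_aux hM p hp x (fun s => by rw [hx, Submodule.mem_colon_singleton]; simp)
  exact ⟨d, y, hy, by ext s; rw [hs]; simp⟩

end Hom
end MG


namespace MG
section Fin
variable {R : Type} [CommRing R]

lemma bdd_coh (J : Ideal R) {N : ℕ} (hpd : ∀ M : ModuleCat.{0} R, HasProjectiveDimensionLT M (N+1))
    (M : Type) [AddCommGroup M] [Module R M] :
    BddAbove {i : ℕ | Nontrivial ((localCohomology J i).obj (ModuleCat.of R M))} := by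
  refine ⟨N, fun i hi => ?_⟩
  by_contra hlt
  obtain ⟨k, rfl⟩ : ∃ k, i = k + 1 := ⟨i - 1, by omega⟩
  have := (subsing_iff_van J k (ModuleCat.of R M)).2 (van_large J hpd _ (by omega))
  exact not_nontrivial_iff_subsingleton.2 this hi

lemma van_of_gt (J : Ideal R) {N : ℕ} (hpd : ∀ M : ModuleCat.{0} R, HasProjectiveDimensionLT M (N+1))
    (M : Type) [AddCommGroup M] [Module R M] (t : ℕ) (ht : cohDim R J M < t) :
    Van J t (ModuleCat.of R M) := by
  obtain ⟨k, rfl⟩ : ∃ k, t = k + 1 := ⟨t - 1, by omega⟩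
  rw [← subsing_iff_van, ← not_nontrivial_iff_subsingleton]
  intro h
  exact absurd (le_csSup (bdd_coh J hpd M) h) (not_le.2 ht)

lemma cohDim_le (J : Ideal R) (M : Type) [AddCommGroup M] [Module R M] (c : ℕ)
    (h : ∀ t, c < t → Van J t (ModuleCat.of R M)) : cohDim R J M ≤ c := by
  refine csSup_le' fun i hi => ?_
  by_contra hlt
  obtain ⟨k, rfl⟩ : ∃ k, i = k + 1 := ⟨i - 1, by omega⟩
  have := (subsing_iff_van J k (ModuleCat.of R M)).2 (h _ (by omega))
  exact not_nontrivial_iff_subsingleton.2 this hi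

lemma cohDim_equiv (J : Ideal R) {A B : Type} [AddCommGroup A] [AddCommGroup B] [Module R A] [Module R B]
    (e : A ≃ₗ[R] B) : cohDim R J A = cohDim R J B := by
  unfold cohDim
  congr 1
  ext i
  exact ((localCohomology J i).mapIso e.toModuleIso).toLinearEquiv.toEquiv.nontrivial_congr

lemma cohDim_prime_le [IsNoetherianRing R] (J : Ideal R) {N : ℕ}
    (hpd : ∀ M : ModuleCat.{0} R, HasProjectiveDimensionLT M (N+1))
    (D : Type) [AddCommGroup D] [Module R D] [Module.Finite R D] (p : Ideal R)
    (hp : p ∈ associatedPrimes R D) : cohDim R J (R ⧸ p) ≤ cohDim R J D :=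
  cohDim_le _ _ _ fun t ht => van_primes J hpd _ D (fun t ht => van_of_gt J hpd D t ht) p hp.isPrime
      (Submodule.annihilator_top.ge.trans (IsAssociatedPrime.annihilator_le hp)) t ht

end Fin
end MG

theorem mgrade_eq_cohDim_first_step
    (K : Type) [Field K] (m n : ℕ)
    (M : Type) [AddCommGroup M] [Module (BGS K m n) M] [Module.Finite (BGS K m n) M]
    (ℳ : ℕ × ℕ → AddSubgroup M) (hM : IsBigrading K m n M ℳ)
    (r : ℕ) (D : Fin (r + 1) → Submodule (BGS K m n) M)
    (hD : IsDimFiltration K m n ℳ r D) (i : Fin r) :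
    mCohDim (BGS K m n) (idealQ K m n) ↥(D i.succ)
      = cohDim (BGS K m n) (idealQ K m n) ↥(D ⟨1, Nat.succ_lt_succ i.pos⟩) := by
  have hpd := MG.pd_mv K m n
  set one : Fin (r + 1) := ⟨1, Nat.succ_lt_succ i.pos⟩ with hone
  have hmono : StrictMono fun j => cohDim (BGS K m n) (idealQ K m n) ↥(D j) :=
    Fin.strictMono_iff_lt_succ.2 hD.cd_lt
  have hone_le : ∀ j : Fin r, one ≤ j.succ := by
    intro j; rw [Fin.le_def]; simp [hone]
  -- lower bound
  have lower : ∀ N : Submodule (BGS K m n) M, IsBigradedSubmodule K m n ℳ N → N ≠ ⊥ →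
      ∀ j, N ≤ D j → cohDim (BGS K m n) (idealQ K m n) ↥(D one) ≤
        cohDim (BGS K m n) (idealQ K m n) ↥N := by
    intro N hN hne j
    induction j using Fin.induction with
    | zero => intro h; rw [hD.bot, le_bot_iff] at h; exact absurd h hne
    | succ j ih =>
      intro h
      by_cases h' : N ≤ D j.castSucc
      · exact ih h'
      · have h1 := mt (hD.largest j N hN h) h'
        exact (hmono.monotone (hone_le j)).trans (not_lt.1 h1)
  have lowerp : ∀ p ∈ associatedPrimes (BGS K m n) ↥(D i.succ),
      cohDim (BGS K m n) (idealQ K m n) ↥(D one) ≤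
        cohDim (BGS K m n) (idealQ K m n) (BGS K m n ⧸ p) := by
    intro p hp
    have hpM : p ∈ associatedPrimes (BGS K m n) M :=
      associatedPrimes.subset_of_injective (f := (D i.succ).subtype) Subtype.val_injective hp
    obtain ⟨hprime, d, y, hy, hpy⟩ := MG.hom_ass hM p hpM
    have hy0 : y ≠ 0 := by
      rintro rfl
      apply hprime.ne_top
      rw [hpy]; simp
    let f := LinearMap.toSpanSingleton (BGS K m n) M y
    have e : (BGS K m n ⧸ p) ≃ₗ[BGS K m n] ↥(LinearMap.range f) :=
      (Submodule.quotEquivOfEq p _ hpy).trans f.quotKerEquivRange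
    rw [MG.cohDim_equiv _ e]
    have hr : LinearMap.range f = Submodule.span (BGS K m n) {y} :=
      LinearMap.range_toSpanSingleton y
    refine lower _ ?_ ?_ (Fin.last r) (by rw [hD.top]; exact le_top)
    · rw [hr]
      refine le_antisymm (Submodule.span_mono ?_) (Submodule.span_le.2 fun x hx => hx.1)
      rintro x rfl
      exact ⟨Submodule.mem_span_singleton_self _, d, hy⟩
    · rw [hr]; simpa using hy0
  -- attainment
  have hnt : Nontrivial ↥(D one) := by
    rw [Submodule.nontrivial_iff_ne_bot, ← hD.bot]
    exact (hD.strictMono (show (0 : Fin (r+1)) < one by rw [Fin.lt_def]; simp [hone])).ne'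
  obtain ⟨p, hp⟩ := associatedPrimes.nonempty (BGS K m n) ↥(D one)
  have hle : D one ≤ D i.succ := hD.strictMono.monotone (hone_le i)
  have hp' : p ∈ associatedPrimes (BGS K m n) ↥(D i.succ) :=
    associatedPrimes.subset_of_injective (f := Submodule.inclusion hle)
      (Submodule.inclusion_injective hle) hp
  have hup : cohDim (BGS K m n) (idealQ K m n) (BGS K m n ⧸ p) ≤
      cohDim (BGS K m n) (idealQ K m n) ↥(D one) := by
    exact MG.cohDim_prime_le (idealQ K m n) hpd ↥(D one) p hp
  unfold mCohDim
  refine le_antisymm (le_trans (Nat.sInf_le ⟨p, hp', rfl⟩) hup) ?_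
  refine le_csInf ⟨_, p, hp', rfl⟩ ?_
  rintro _ ⟨q, hq, rfl⟩
  exact lowerp q hq
end
end
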